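/- arXiv:2301.06191 — 11 statements merged into one kernel-verified Lean document; each statement's English description precedes it below -/
import Mathlib

section
/- Let u be as in the context (a radial solution of the Sinh–Gordon equation describing an N-vortex). Then u'(r) > 0 for all r ∈ (0, ∞). -/
/-- Just to the right of a point with negative derivative, a function is below its value there. -/
lemma eventually_right_lt_of_hasDerivAt_neg {f : ℝ → ℝ} {f' x : ℝ}
    (hf : HasDerivAt f f' x) (hneg : f' < 0) :
    ∀ᶠ y in nhdsWithin x (Set.Ioi x), f y < f x := by
  have h := (hasDerivWithinAt_iff_tendsto_slope' Set.self_notMem_Ioi).1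
    (hf.hasDerivWithinAt (s := Set.Ioi x))
  filter_upwards [h.eventually (gt_mem_nhds hneg), self_mem_nhdsWithin] with y hy hxy
  have hxy' : 0 < y - x := sub_pos.2 hxy
  rw [slope_def_field, div_lt_iff₀ hxy'] at hy
  linarith

/-- A solution of the radial Sinh–Gordon equation which decays at infinity is strictly increasing
wherever it is negative. Here `w r = r * u' r`. -/
lemma sinhGordon_flux_pos_of_neg {u w : ℝ → ℝ}
    (hu : ∀ r, 0 < r → HasDerivAt u (w r / r) r)
    (hw : ∀ r, 0 < r → HasDerivAt w (r * (Real.exp (u r / 2) - Real.exp (-(u r) / 2))) r)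
    (htop : Filter.Tendsto u Filter.atTop (nhds 0)) {b : ℝ} (hb : 0 < b) (hub : u b < 0) :
    0 < w b := by
  by_contra! hwb
  have hcont : ContinuousOn u (Set.Ici b) := fun r hr =>
    (hu r (hb.trans_le hr)).continuousAt.continuousWithinAt
  obtain ⟨m, hm, hmin⟩ : ∃ m ∈ Set.Ici b, IsMinOn u (Set.Ici b) m := by
    refine hcont.exists_isMinOn' isClosed_Ici (Set.self_mem_Ici (a := b)) ?_
    rw [Filter.eventually_inf_principal, cocompact_eq_atBot_atTop, Filter.eventually_sup]
    constructor
    · filter_upwards [Filter.eventually_lt_atBot b] with x hx hx'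
      exact absurd hx (not_lt.2 hx')
    · filter_upwards [htop.eventually (lt_mem_nhds hub)] with x hx _ using hx.le
  have hm0 : 0 < m := hb.trans_le hm
  have hum : u m < 0 := (hmin (Set.self_mem_Ici (a := b))).trans_lt hub
  have hwm : w m ≤ 0 := by
    rcases (show b ≤ m from hm).eq_or_lt with rfl | hlt
    · exact hwb
    · have hz := (hmin.isLocalMin (Ici_mem_nhds hlt)).hasDerivAt_eq_zero (hu m hm0)
      rcases div_eq_zero_iff.1 hz with h | h <;> linarith
  have hforce : m * (Real.exp (u m / 2) - Real.exp (-(u m) / 2)) < 0 :=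
    mul_neg_of_pos_of_neg hm0 (sub_neg.2 (Real.exp_lt_exp.2 (by linarith)))
  have hev := eventually_right_lt_of_hasDerivAt_neg (hw m hm0) hforce
  obtain ⟨e, he, hsub⟩ := (mem_nhdsGT_iff_exists_Ioo_subset).1 hev
  have he' : m < e := he
  have hanti : StrictAntiOn u (Set.Ico m e) := by
    refine strictAntiOn_of_deriv_neg (convex_Ico m e)
      (hcont.mono fun r hr => (show b ≤ m from hm).trans hr.1) fun r hr => ?_
    rw [interior_Ico] at hr
    have hr0 : 0 < r := hm0.trans hr.1
    rw [(hu r hr0).deriv]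
    have : w r < w m := hsub hr
    exact div_neg_of_neg_of_pos (by linarith) hr0
  have h1 := hanti ⟨le_rfl, he'⟩ (⟨by linarith, by linarith⟩ : (m + e) / 2 ∈ Set.Ico m e)
    (by linarith)
  have h2 : u m ≤ u ((m + e) / 2) :=
    hmin (show b ≤ (m + e) / 2 by have : b ≤ m := hm; linarith)
  linarith

/-- For `x ∈ [-1, 0]` the Sinh–Gordon nonlinearity is controlled linearly. -/
lemma exp_half_sub_exp_neg_half_ge {x : ℝ} (h1 : -1 ≤ x) (h0 : x ≤ 0) :
    3 / 2 * x ≤ Real.exp (x / 2) - Real.exp (-x / 2) := by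
  have ha := Real.add_one_le_exp (x / 2)
  have hprod : Real.exp (x / 2) * Real.exp (-x / 2) = 1 := by
    rw [← Real.exp_add, show x / 2 + -x / 2 = 0 by ring, Real.exp_zero]
  have hb : Real.exp (-x / 2) ≤ 1 - x := by
    have hpos := Real.exp_pos (-x / 2)
    nlinarith [mul_le_mul_of_nonneg_right ha hpos.le]
  linarith

/-- Backward uniqueness at a zero of `u`: a solution which is negative with nonnegative flux on
the left of `c` cannot reach `c` with both value and flux equal to zero. -/
lemma sinhGordon_flux_ne_zero_of_left_neg {u w : ℝ → ℝ}
    (hu : ∀ r, 0 < r → HasDerivAt u (w r / r) r)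
    (hw : ∀ r, 0 < r → HasDerivAt w (r * (Real.exp (u r / 2) - Real.exp (-(u r) / 2))) r)
    {a c : ℝ} (ha : 0 < a) (hac : a < c) (huc : u c = 0)
    (hneg : ∀ r ∈ Set.Ico a c, u r < 0) (hpos : ∀ r ∈ Set.Ico a c, 0 ≤ w r) : w c ≠ 0 := by
  intro hwc
  have hc : 0 < c := ha.trans hac
  have hev : ∀ᶠ r in nhds c, -1 < u r :=
    (hu c hc).continuousAt.eventually (lt_mem_nhds (by rw [huc]; norm_num))
  obtain ⟨l, hl, hlsub⟩ := exists_Ioc_subset_of_mem_nhds hev ⟨a, hac⟩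
  obtain ⟨d, hd, hdc⟩ := exists_between (max_lt hl hac)
  obtain ⟨hld, had⟩ := max_lt_iff.1 hd
  have hd0 : 0 < d := ha.trans had
  set K : ℝ := 3 / 2 * c + 1 / d with hK
  have hder : ∀ r, 0 < r → HasDerivAt (fun r => (w r - u r) * Real.exp (K * r))
      ((r * (Real.exp (u r / 2) - Real.exp (-(u r) / 2)) - w r / r) * Real.exp (K * r)
        + (w r - u r) * (Real.exp (K * r) * (K * 1))) r := fun r hr =>
    ((hw r hr).sub (hu r hr)).mul (((hasDerivAt_id r).const_mul K).exp)
  have hmono : MonotoneOn (fun r => (w r - u r) * Real.exp (K * r)) (Set.Icc d c) := by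
    refine monotoneOn_of_deriv_nonneg (convex_Icc d c)
      (fun r hr => (hder r (hd0.trans_le hr.1)).continuousAt.continuousWithinAt)
      (fun r hr => ?_) fun r hr => ?_
    · rw [interior_Icc] at hr
      exact (hder r (hd0.trans hr.1)).differentiableAt.differentiableWithinAt
    · rw [interior_Icc] at hr
      have hr0 : 0 < r := hd0.trans hr.1
      rw [(hder r hr0).deriv]
      have hmem : r ∈ Set.Ico a c := ⟨(had.trans hr.1).le, hr.2⟩
      have hur := hneg r hmem
      have hwr := hpos r hmem
      have hur1 : -1 < u r := hlsub ⟨hld.trans hr.1, hr.2.le⟩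
      have hf := mul_le_mul_of_nonneg_left (exp_half_sub_exp_neg_half_ge hur1.le hur.le) hr0.le
      have h1 : w r / r ≤ w r * (1 / d) := by
        rw [mul_one_div]
        exact div_le_div_of_nonneg_left hwr hd0 hr.1.le
      have h2 : r * (3 / 2 * u r) ≥ c * (3 / 2 * u r) :=
        mul_le_mul_of_nonpos_right hr.2.le (by linarith)
      have h3 : 0 ≤ w r * (3 / 2 * c) := by positivity
      have h4 : 0 ≤ -u r * (1 / d) := mul_nonneg (by linarith) (by positivity)
      have h5 : 0 ≤ r * (Real.exp (u r / 2) - Real.exp (-(u r) / 2)) - w r / r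
          + (w r - u r) * K := by rw [hK]; linarith
      calc (0 : ℝ) ≤ (r * (Real.exp (u r / 2) - Real.exp (-(u r) / 2)) - w r / r
          + (w r - u r) * K) * Real.exp (K * r) := mul_nonneg h5 (Real.exp_pos _).le
        _ = _ := by ring
  have h := hmono ⟨le_rfl, hdc.le⟩ ⟨hdc.le, le_rfl⟩ hdc.le
  simp only [huc, hwc, sub_zero, zero_mul] at h
  have hdm : d ∈ Set.Ico a c := ⟨had.le, hdc⟩
  have : 0 < (w d - u d) * Real.exp (K * d) :=
    mul_pos (by linarith [hneg d hdm, hpos d hdm]) (Real.exp_pos _)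
  linarith

/-- A decaying radial Sinh–Gordon solution which is negative at `a` stays negative after `a`. -/
lemma sinhGordon_neg_of_neg {u w : ℝ → ℝ}
    (hu : ∀ r, 0 < r → HasDerivAt u (w r / r) r)
    (hw : ∀ r, 0 < r → HasDerivAt w (r * (Real.exp (u r / 2) - Real.exp (-(u r) / 2))) r)
    (htop : Filter.Tendsto u Filter.atTop (nhds 0)) {a b : ℝ} (ha : 0 < a) (hab : a ≤ b)
    (hua : u a < 0) : u b < 0 := by
  by_contra! hub
  have hcont : ContinuousOn u (Set.Icc a b) := fun r hr =>
    (hu r (ha.trans_le hr.1)).continuousAt.continuousWithinAt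
  have hclosed : IsClosed (Set.Icc a b ∩ u ⁻¹' Set.Ici 0) :=
    hcont.preimage_isClosed_of_isClosed isClosed_Icc isClosed_Ici
  obtain ⟨c, ⟨hcm, huc⟩, hleast⟩ :=
    (isCompact_Icc.of_isClosed_subset hclosed Set.inter_subset_left).exists_isLeast
      ⟨b, ⟨hab, le_rfl⟩, hub⟩
  have huc0 : 0 ≤ u c := huc
  have hac : a < c := hcm.1.lt_of_ne (by rintro rfl; linarith)
  have hc : 0 < c := ha.trans hac
  have hneg : ∀ r ∈ Set.Ico a c, u r < 0 := fun r hr => by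
    by_contra! h
    exact absurd (hleast ⟨⟨hr.1, hr.2.le.trans hcm.2⟩, h⟩) (not_le.2 hr.2)
  have hpos : ∀ r ∈ Set.Ico a c, 0 ≤ w r := fun r hr =>
    (sinhGordon_flux_pos_of_neg hu hw htop (ha.trans_le hr.1) (hneg r hr)).le
  have hleft : Set.Ico a c ∈ nhdsWithin c (Set.Iio c) := Ico_mem_nhdsLT hac
  have huc' : u c = 0 := le_antisymm
    (le_of_tendsto (hu c hc).continuousAt.continuousWithinAt.tendsto
      (Filter.mem_of_superset hleft fun r hr => (hneg r hr).le)) huc0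
  have hwc0 : 0 ≤ w c := ge_of_tendsto (hw c hc).continuousAt.continuousWithinAt.tendsto
      (Filter.mem_of_superset hleft hpos)
  have hwc : 0 < w c := hwc0.lt_of_ne
    (sinhGordon_flux_ne_zero_of_left_neg hu hw ha hac huc' hneg hpos).symm
  have hu_lt : ∀ᶠ r in nhdsWithin c (Set.Ioi c), -u r < -u c :=
    eventually_right_lt_of_hasDerivAt_neg (hu c hc).neg (neg_lt_zero.2 (div_pos hwc hc))
  have hw_pos : ∀ᶠ r in nhdsWithin c (Set.Ioi c), 0 < w r :=
    (hw c hc).continuousAt.continuousWithinAt.eventually (lt_mem_nhds hwc)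
  obtain ⟨r, ⟨hur, hwr⟩, hcr⟩ := ((hu_lt.and hw_pos).and self_mem_nhdsWithin).exists
  have hr0 : 0 < r := hc.trans hcr
  have := sinhGordon_flux_pos_of_neg (u := fun r => -u r) (w := fun r => -w r)
    (fun s hs => by simpa only [neg_div] using (hu s hs).fun_neg)
    (fun s hs => (hw s hs).fun_neg.congr_deriv (by rw [neg_neg]; ring))
    (by simpa using htop.neg) hr0 (by linarith)
  linarith

theorem sinhGordon_vortex_deriv_pos
    (N : ℕ) (hN : 0 < N) (u u' u'' : ℝ → ℝ)
    (hder1 : ∀ r ∈ Set.Ioi (0:ℝ), HasDerivAt u (u' r) r)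
    (hder2 : ∀ r ∈ Set.Ioi (0:ℝ), HasDerivAt u' (u'' r) r)
    (hcont : ContinuousOn u'' (Set.Ioi (0:ℝ)))
    (hne : ∃ r ∈ Set.Ioi (0:ℝ), u r ≠ 0)
    (hODE : ∀ r ∈ Set.Ioi (0:ℝ),
      u'' r + u' r / r = Real.exp (u r / 2) - Real.exp (-(u r) / 2))
    (hlim0 : Filter.Tendsto (fun r => r * u' r) (nhdsWithin 0 (Set.Ioi 0))
      (nhds (4 * (N:ℝ) / ((N:ℝ) + 2))))
    (hbot : Filter.Tendsto u (nhdsWithin 0 (Set.Ioi 0)) Filter.atBot)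
    (htop : Filter.Tendsto u Filter.atTop (nhds 0)) :
    ∀ r ∈ Set.Ioi (0:ℝ), 0 < u' r := by
  have hu : ∀ r, 0 < r → HasDerivAt u (r * u' r / r) r := fun r hr => by
    rw [mul_div_cancel_left₀ _ hr.ne']
    exact hder1 r hr
  have hw : ∀ r, 0 < r → HasDerivAt (fun r => r * u' r)
      (r * (Real.exp (u r / 2) - Real.exp (-(u r) / 2))) r := fun r hr => by
    refine ((hasDerivAt_id' r).mul (hder2 r hr)).congr_deriv ?_
    have hr' : r ≠ 0 := hr.ne'
    rw [← hODE r hr]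
    field_simp
    ring
  intro r hr
  have hr0 : 0 < r := hr
  obtain ⟨a, hua, ha0, har⟩ := ((hbot.eventually (Filter.eventually_lt_atBot 0)).and
    (Ioo_mem_nhdsGT hr0)).exists
  have hur : u r < 0 := sinhGordon_neg_of_neg hu hw htop ha0 har.le hua
  exact pos_of_mul_pos_right (sinhGordon_flux_pos_of_neg hu hw htop hr0 hur) hr0.le
end

section
/- Let u be as in the context (a radial solution of the Sinh–Gordon equation describing an N-vortex). Then u(r) < 0 for all r ∈ (0, ∞). -/
/-- A function with positive second derivative at a point has no local maximum there. -/
theorem not_isLocalMax_of_deriv_deriv_pos {f : ℝ → ℝ} {x : ℝ}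
    (h2 : 0 < deriv (deriv f) x) (hc : ContinuousAt f x) : ¬ IsLocalMax f x := by
  intro hmax
  have hmin : IsLocalMin f x := isLocalMin_of_deriv_deriv_pos h2 hmax.deriv_eq_zero hc
  have hconst : f =ᶠ[nhds x] fun _ => f x := by
    filter_upwards [hmax, hmin] with y h₁ h₂ using le_antisymm h₁ h₂
  have hzero : deriv (deriv f) x = 0 := by
    rw [hconst.deriv.deriv_eq]
    simp
  exact h2.ne' hzero

/-- A function on the half-line which tends to `-∞` at `0`, to `0` at `∞` and is strictly convex at
each critical point with positive value is nonpositive. -/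
theorem nonpos_of_second_deriv_pos {u u' u'' : ℝ → ℝ}
    (hder1 : ∀ r ∈ Set.Ioi (0:ℝ), HasDerivAt u (u' r) r)
    (hder2 : ∀ r ∈ Set.Ioi (0:ℝ), HasDerivAt u' (u'' r) r)
    (hconv : ∀ r ∈ Set.Ioi (0:ℝ), 0 < u r → u' r = 0 → 0 < u'' r)
    (hbot : Filter.Tendsto u (nhdsWithin 0 (Set.Ioi 0)) Filter.atBot)
    (htop : Filter.Tendsto u Filter.atTop (nhds 0)) :
    ∀ r ∈ Set.Ioi (0:ℝ), u r ≤ 0 := by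
  intro p hp
  by_contra! hup
  obtain ⟨a, ⟨hua, hap⟩, ha⟩ := (((hbot.eventually_lt_atBot (u p)).and
    (mem_nhdsWithin_of_mem_nhds (Iio_mem_nhds hp))).and self_mem_nhdsWithin).exists
  obtain ⟨b, hub, hpb⟩ := ((htop.eventually_lt_const hup).and
    (Filter.eventually_gt_atTop p)).exists
  simp only [Set.mem_Ioi] at ha hap hp
  have hcontu : ContinuousOn u (Set.Icc a b) := fun r hr =>
    (hder1 r (ha.trans_le hr.1)).continuousAt.continuousWithinAt
  obtain ⟨x, hx, hmax⟩ := isCompact_Icc.exists_isMaxOn ⟨p, hap.le, hpb.le⟩ hcontu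
  have hpx : u p ≤ u x := hmax ⟨hap.le, hpb.le⟩
  have hax : a < x := lt_of_le_of_ne hx.1 (by rintro rfl; linarith)
  have hxb : x < b := lt_of_le_of_ne hx.2 (by rintro rfl; linarith)
  have hx0 : 0 < x := ha.trans hax
  have hloc : IsLocalMax u x := hmax.isLocalMax (Icc_mem_nhds hax hxb)
  have hderiv : deriv u =ᶠ[nhds x] u' := by
    filter_upwards [Ioi_mem_nhds hx0] with y hy using (hder1 y hy).deriv
  refine not_isLocalMax_of_deriv_deriv_pos ?_ (hder1 x hx0).continuousAt hloc
  rw [hderiv.deriv_eq, (hder2 x hx0).deriv]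
  exact hconv x hx0 (hup.trans_le hpx) (hloc.hasDerivAt_eq_zero (hder1 x hx0))

/-- Linear lower bound for `exp (t / 2) - exp (-t / 2)` on `[-M, 0]`. -/
theorem mul_le_exp_half_sub_exp_neg_half {t M : ℝ} (ht : t ≤ 0) (hM : -M ≤ t) :
    Real.exp (M / 2) * t ≤ Real.exp (t / 2) - Real.exp (-t / 2) := by
  have h₁ : Real.exp (t / 2) = Real.exp (-t / 2) * Real.exp t := by
    rw [← Real.exp_add]; ring_nf
  have h₂ : Real.exp (-t / 2) ≤ Real.exp (M / 2) := Real.exp_le_exp.2 (by linarith)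
  have h₃ := Real.add_one_le_exp t
  rw [h₁]
  nlinarith [Real.exp_pos (-t / 2)]

theorem exp_half_sub_exp_neg_half_nonpos {t : ℝ} (ht : t ≤ 0) :
    Real.exp (t / 2) - Real.exp (-t / 2) ≤ 0 :=
  sub_nonpos.2 (Real.exp_le_exp.2 (by linarith))

/-- A nonpositive radial solution of the Sinh–Gordon equation that vanishes at a point vanishes
at all smaller radii. -/
theorem sinhGordon_eq_zero_of_nonpos {u u' u'' : ℝ → ℝ}
    (hder1 : ∀ r ∈ Set.Ioi (0:ℝ), HasDerivAt u (u' r) r)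
    (hder2 : ∀ r ∈ Set.Ioi (0:ℝ), HasDerivAt u' (u'' r) r)
    (hODE : ∀ r ∈ Set.Ioi (0:ℝ),
      u'' r + u' r / r = Real.exp (u r / 2) - Real.exp (-(u r) / 2))
    (hnonpos : ∀ r ∈ Set.Ioi (0:ℝ), u r ≤ 0) {a b : ℝ} (ha : 0 < a) (hab : a ≤ b)
    (hb : u b = 0) : u a = 0 := by
  have hb0 : 0 < b := ha.trans_le hab
  have hpos : ∀ r ∈ Set.Icc a b, 0 < r := fun r hr => ha.trans_le hr.1
  have hub' : u' b = 0 := by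
    refine IsLocalMax.hasDerivAt_eq_zero ?_ (hder1 b hb0)
    filter_upwards [Ioi_mem_nhds hb0] with y hy using (hnonpos y hy).trans_eq hb.symm
  have hv : ∀ r, 0 < r → HasDerivAt (fun s => s * u' s)
      (r * (Real.exp (u r / 2) - Real.exp (-(u r) / 2))) r := by
    intro r hr
    refine ((hasDerivAt_id' r).mul (hder2 r hr)).congr_deriv ?_
    rw [← hODE r hr]
    field_simp
    ring
  have hvanti : AntitoneOn (fun s => s * u' s) (Set.Icc a b) := by
    refine antitoneOn_of_hasDerivWithinAt_nonpos (convex_Icc a b)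
      (fun r hr => (hv r (hpos r hr)).continuousAt.continuousWithinAt)
      (fun r hr => (hv r (hpos r (interior_subset hr))).hasDerivWithinAt) fun r hr => ?_
    have hr0 := hpos r (interior_subset hr)
    exact mul_nonpos_of_nonneg_of_nonpos hr0.le
      (exp_half_sub_exp_neg_half_nonpos (hnonpos r hr0))
  have hvnonneg : ∀ r ∈ Set.Icc a b, 0 ≤ r * u' r := fun r hr => by
    have := hvanti hr ⟨hab, le_rfl⟩ hr.2
    simpa [hub'] using this
  have hu'nonneg : ∀ r ∈ Set.Icc a b, 0 ≤ u' r := fun r hr =>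
    nonneg_of_mul_nonneg_right (hvnonneg r hr) (hpos r hr)
  have humono : MonotoneOn u (Set.Icc a b) :=
    monotoneOn_of_hasDerivWithinAt_nonneg (convex_Icc a b)
      (fun r hr => (hder1 r (hpos r hr)).continuousAt.continuousWithinAt)
      (fun r hr => (hder1 r (hpos r (interior_subset hr))).hasDerivWithinAt)
      fun r hr => hu'nonneg r (interior_subset hr)
  set C := b * Real.exp (-u a / 2) with hC
  set L := C + 1 / a with hL
  have hC0 : 0 ≤ C := by positivity
  have hw : ∀ r, 0 < r → HasDerivAt (fun s => Real.exp (L * s) * (s * u' s - u s))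
      (Real.exp (L * r) * (L * (r * u' r - u r)
        + (r * (Real.exp (u r / 2) - Real.exp (-(u r) / 2)) - u' r))) r := by
    intro r hr
    refine ((((hasDerivAt_id' r).const_mul L).exp).mul
      ((hv r hr).sub (hder1 r hr))).congr_deriv ?_
    simp only [Pi.sub_apply]
    ring
  have hwmono : MonotoneOn (fun s => Real.exp (L * s) * (s * u' s - u s)) (Set.Icc a b) := by
    refine monotoneOn_of_hasDerivWithinAt_nonneg (convex_Icc a b)
      (fun r hr => (hw r (hpos r hr)).continuousAt.continuousWithinAt)
      (fun r hr => (hw r (hpos r (interior_subset hr))).hasDerivWithinAt) fun r hr => ?_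
    have hr' := interior_subset hr
    have hr0 := hpos r hr'
    have hur := hnonpos r hr0
    have hlow := mul_le_exp_half_sub_exp_neg_half (M := -u a) hur
      (by simpa using humono ⟨le_rfl, hab⟩ hr' hr'.1)
    have h₁ : C * u r ≤ r * (Real.exp (u r / 2) - Real.exp (-(u r) / 2)) := by
      calc C * u r = b * (Real.exp (-u a / 2) * u r) := by rw [hC]; ring
        _ ≤ r * (Real.exp (-u a / 2) * u r) :=
          mul_le_mul_of_nonpos_right hr'.2
            (mul_nonpos_of_nonneg_of_nonpos (Real.exp_pos _).le hur)
        _ ≤ _ := mul_le_mul_of_nonneg_left hlow hr0.le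
    have h₂ : u' r ≤ 1 / a * (r * u' r) := by
      have : 1 ≤ r / a := (one_le_div ha).2 hr'.1
      calc u' r ≤ r / a * u' r := le_mul_of_one_le_left (hu'nonneg r hr') this
        _ = _ := by ring
    have h₃ : 0 ≤ C * (r * u' r) := mul_nonneg hC0 (hvnonneg r hr')
    have h₄ : 0 ≤ 1 / a * (-u r) := mul_nonneg (by positivity) (by linarith)
    refine mul_nonneg (Real.exp_pos _).le ?_
    rw [hL]
    linarith
  have hfin := hwmono ⟨le_rfl, hab⟩ ⟨hab, le_rfl⟩ hab
  simp only [hub', hb, mul_zero, sub_zero] at hfin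
  have hwa := nonpos_of_mul_nonpos_right hfin (Real.exp_pos _)
  linarith [hvnonneg a ⟨le_rfl, hab⟩, hnonpos a ha]


theorem sinhGordon_vortex_neg
    (N : ℕ) (hN : 0 < N) (u u' u'' : ℝ → ℝ)
    (hder1 : ∀ r ∈ Set.Ioi (0:ℝ), HasDerivAt u (u' r) r)
    (hder2 : ∀ r ∈ Set.Ioi (0:ℝ), HasDerivAt u' (u'' r) r)
    (hcont : ContinuousOn u'' (Set.Ioi (0:ℝ)))
    (hne : ∃ r ∈ Set.Ioi (0:ℝ), u r ≠ 0)
    (hODE : ∀ r ∈ Set.Ioi (0:ℝ),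
      u'' r + u' r / r = Real.exp (u r / 2) - Real.exp (-(u r) / 2))
    (hlim0 : Filter.Tendsto (fun r => r * u' r) (nhdsWithin 0 (Set.Ioi 0))
      (nhds (4 * (N:ℝ) / ((N:ℝ) + 2))))
    (hbot : Filter.Tendsto u (nhdsWithin 0 (Set.Ioi 0)) Filter.atBot)
    (htop : Filter.Tendsto u Filter.atTop (nhds 0)) :
    ∀ r ∈ Set.Ioi (0:ℝ), u r < 0 := by
  have hnonpos : ∀ r ∈ Set.Ioi (0:ℝ), u r ≤ 0 := by
    refine nonpos_of_second_deriv_pos hder1 hder2 (fun r hr hur hu'r => ?_) hbot htop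
    have h := hODE r hr
    rw [hu'r, zero_div, add_zero] at h
    rw [h, sub_pos]
    exact Real.exp_lt_exp.2 (by linarith)
  intro r hr
  refine lt_of_le_of_ne (hnonpos r hr) fun hzero => ?_
  obtain ⟨a, ⟨hua, har⟩, ha⟩ := (((hbot.eventually_lt_atBot 0).and
    (mem_nhdsWithin_of_mem_nhds (Iio_mem_nhds hr))).and self_mem_nhdsWithin).exists
  exact hua.ne (sinhGordon_eq_zero_of_nonpos hder1 hder2 hODE hnonpos ha (le_of_lt har) hzero)
end

section
/- Let u be as in the context (a radial solution of the Sinh–Gordon equation describing an N-vortex). Then for every r > 0 the function r ↦ r·u'(r) satisfies the identity (r·u'(r))' = r(e^{u(r)/2} − e^{−u(r)/2}), it is strictly decreasing on (0,∞), and consequently 0 < r·u'(r) < 4N/(N+2) for all r ∈ (0, ∞). -/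
/-- A radial solution that tends to `-∞` at the origin and to `0` at infinity is nonpositive. -/
lemma sinhGordon_nonpos {u u' : ℝ → ℝ}
    (hu : ∀ r ∈ Set.Ioi (0:ℝ), HasDerivAt u (u' r) r)
    (hg : ∀ r ∈ Set.Ioi (0:ℝ), HasDerivAt (fun t => t * u' t)
      (r * (Real.exp (u r / 2) - Real.exp (-(u r) / 2))) r)
    (hbot : Filter.Tendsto u (nhdsWithin 0 (Set.Ioi 0)) Filter.atBot)
    (htop : Filter.Tendsto u Filter.atTop (nhds 0)) :
    ∀ r ∈ Set.Ioi (0:ℝ), u r ≤ 0 := by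
  intro r₀ hr₀
  by_contra! hpos
  have hc : ∀ a ∈ Set.Ioi (0:ℝ), ContinuousAt u a := fun a ha => (hu a ha).continuousAt
  obtain ⟨δ, hδ, hδu⟩ := mem_nhdsGT_iff_exists_Ioo_subset.1 (hbot.eventually_lt_atBot 0)
  obtain ⟨R, hR⟩ := Filter.eventually_atTop.1 (htop.eventually_lt_const hpos)
  simp only [Set.mem_Ioi] at hδ hr₀
  have hδr : δ ≤ r₀ := by
    by_contra! h
    exact absurd (hδu ⟨hr₀, h⟩) (not_lt.2 hpos.le)
  have hrR : r₀ ≤ R := by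
    by_contra! h
    exact lt_irrefl _ (hR r₀ h.le)
  obtain ⟨b, hb, hmax⟩ := (isCompact_Icc (a := δ) (b := R)).exists_isMaxOn ⟨r₀, hδr, hrR⟩
    (f := u) fun x hx => (hc x (hδ.trans_le hx.1)).continuousWithinAt
  have hub : u r₀ ≤ u b := hmax ⟨hδr, hrR⟩
  have hb0 : 0 < b := hδ.trans_le hb.1
  have hglob : ∀ x, 0 < x → u x ≤ u b := by
    intro x hx
    by_cases h1 : x < δ
    · exact ((hδu ⟨hx, h1⟩ : u x < 0).le.trans hpos.le).trans hub
    by_cases h2 : x ≤ R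
    · exact hmax ⟨not_lt.1 h1, h2⟩
    · exact (hR x (not_le.1 h2).le).le.trans hub
  have hlm : IsLocalMax u b := by
    filter_upwards [Ioi_mem_nhds hb0] with x hx using hglob x hx
  have hb' : u' b = 0 := hlm.hasDerivAt_eq_zero (hu b hb0)
  obtain ⟨ε, hε, hεu⟩ := Metric.eventually_nhds_iff.1
    ((hc b hb0).eventually_const_lt (hpos.trans_le hub))
  have hpos' : ∀ x ∈ Set.Icc b (b + ε / 2), 0 < x ∧ 0 < u x := by
    intro x hx
    refine ⟨hb0.trans_le hx.1, hεu ?_⟩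
    rw [Real.dist_eq, abs_of_nonneg (by linarith [hx.1])]
    linarith [hx.2]
  have hgm : StrictMonoOn (fun t => t * u' t) (Set.Icc b (b + ε / 2)) := by
    refine strictMonoOn_of_hasDerivWithinAt_pos (convex_Icc _ _)
      (fun x hx => (hg x (hpos' x hx).1).continuousAt.continuousWithinAt)
      (fun x hx => (hg x (hpos' x (interior_subset hx)).1).hasDerivWithinAt) fun x hx => ?_
    obtain ⟨h0, h1⟩ := hpos' x (interior_subset hx)
    exact mul_pos h0 (sub_pos.2 (Real.exp_lt_exp.2 (by linarith)))
  have hum : StrictMonoOn u (Set.Icc b (b + ε / 2)) := by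
    refine strictMonoOn_of_hasDerivWithinAt_pos (convex_Icc _ _)
      (fun x hx => (hc x (hpos' x hx).1).continuousWithinAt)
      (fun x hx => (hu x (hpos' x (interior_subset hx)).1).hasDerivWithinAt) fun x hx => ?_
    have hx' := interior_subset hx
    rw [interior_Icc] at hx
    have h := hgm ⟨le_rfl, by linarith⟩ hx' hx.1
    simp only [hb', mul_zero] at h
    exact pos_of_mul_pos_right h (hpos' x hx').1.le
  have hlt := hum ⟨le_rfl, by linarith⟩ ⟨by linarith, le_rfl⟩ (by linarith : b < b + ε / 2)
  linarith [hglob (b + ε / 2) (by linarith)]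

lemma exp_sub_exp_neg_le {x : ℝ} (h0 : 0 ≤ x) (h1 : x ≤ 1) :
    Real.exp x - Real.exp (-x) ≤ 4 * x := by
  have h2 := abs_le.1 (Real.abs_exp_sub_one_le (x := x) (by rwa [abs_of_nonneg h0]))
  have h3 := Real.add_one_le_exp (-x)
  rw [abs_of_nonneg h0] at h2
  linarith [h2.2]

/-- A nonpositive radial solution that tends to `-∞` at the origin never vanishes. -/
lemma sinhGordon_neg {u u' : ℝ → ℝ}
    (hu : ∀ r ∈ Set.Ioi (0:ℝ), HasDerivAt u (u' r) r)
    (hg : ∀ r ∈ Set.Ioi (0:ℝ), HasDerivAt (fun t => t * u' t)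
      (r * (Real.exp (u r / 2) - Real.exp (-(u r) / 2))) r)
    (hbot : Filter.Tendsto u (nhdsWithin 0 (Set.Ioi 0)) Filter.atBot)
    (hnonpos : ∀ r ∈ Set.Ioi (0:ℝ), u r ≤ 0) :
    ∀ r ∈ Set.Ioi (0:ℝ), u r < 0 := by
  intro r₀ hr₀
  refine lt_of_le_of_ne (hnonpos r₀ hr₀) fun hzero => ?_
  have hc : ∀ a ∈ Set.Ioi (0:ℝ), ContinuousAt u a := fun a ha => (hu a ha).continuousAt
  obtain ⟨δ, hδ, hδu⟩ := mem_nhdsGT_iff_exists_Ioo_subset.1 (hbot.eventually_lt_atBot 0)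
  simp only [Set.mem_Ioi] at hδ hr₀
  have hδr : δ ≤ r₀ := by
    by_contra! h
    exact absurd (hδu ⟨hr₀, h⟩) (not_lt.2 hzero.ge)
  have hcomp : IsCompact (Set.Icc δ r₀ ∩ u ⁻¹' {0}) :=
    isCompact_Icc.of_isClosed_subset (ContinuousOn.preimage_isClosed_of_isClosed
      (fun x hx => (hc x (hδ.trans_le hx.1)).continuousWithinAt) isClosed_Icc
      isClosed_singleton) Set.inter_subset_left
  obtain ⟨s, ⟨hs, hus⟩, hleast⟩ := hcomp.exists_isLeast ⟨r₀, ⟨hδr, le_rfl⟩, hzero⟩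
  simp only [Set.mem_preimage, Set.mem_singleton_iff] at hus
  have hs0 : 0 < s := hδ.trans_le hs.1
  have hlm : IsLocalMax u s := by
    filter_upwards [Ioi_mem_nhds hs0] with x hx
    rw [hus]
    exact hnonpos x hx
  have hs' : u' s = 0 := hlm.hasDerivAt_eq_zero (hu s hs0)
  have hneg : ∀ x, 0 < x → x < s → u x < 0 := by
    intro x hx hxs
    refine lt_of_le_of_ne (hnonpos x hx) fun h => ?_
    by_cases h1 : x < δ
    · exact absurd (hδu ⟨hx, h1⟩) (not_lt.2 h.ge)
    · exact absurd (hleast ⟨⟨not_lt.1 h1, hxs.le.trans hs.2⟩, h⟩) (not_le.2 hxs)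
  have hanti : AntitoneOn (fun t => t * u' t) (Set.Ioi 0) := by
    refine antitoneOn_of_hasDerivWithinAt_nonpos (convex_Ioi _)
      (fun x hx => (hg x hx).continuousAt.continuousWithinAt)
      (fun x hx => (hg x (interior_subset hx)).hasDerivWithinAt) fun x hx => ?_
    have hx' := interior_subset hx
    have := hnonpos x hx'
    exact mul_nonpos_of_nonneg_of_nonpos (le_of_lt hx')
      (sub_nonpos.2 (Real.exp_le_exp.2 (by linarith)))
  have hmono : MonotoneOn u (Set.Ioc 0 s) := by
    refine monotoneOn_of_hasDerivWithinAt_nonneg (convex_Ioc _ _)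
      (fun x hx => (hc x hx.1).continuousWithinAt)
      (fun x hx => (hu x (interior_subset hx).1).hasDerivWithinAt) fun x hx => ?_
    have hx' := interior_subset hx
    have h := hanti hx'.1 hs0 hx'.2
    simp only [hs', mul_zero] at h
    exact nonneg_of_mul_nonneg_right h hx'.1
  -- Near its first zero `s`, the size of `u` is controlled by a small multiple of itself.
  obtain ⟨ε, hε, hεu⟩ := Metric.eventually_nhds_iff.1
    ((hc s hs0).eventually_const_lt (show -1 < u s by rw [hus]; norm_num))
  obtain ⟨η, hη0, hη⟩ : ∃ η, 0 < η ∧ η < min ε (min (s / 2) (1 / 4)) :=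
    exists_between (by positivity)
  obtain ⟨hη1, hη2, hη3⟩ : η < ε ∧ η < s / 2 ∧ η < 1 / 4 := by simpa using hη
  have ha0 : 0 < s - η := by linarith
  have hau : -1 < u (s - η) := hεu (by
    rw [Real.dist_eq, show s - η - s = -η by ring, abs_neg, abs_of_pos hη0]; exact hη1)
  have hm := hneg (s - η) ha0 (by linarith)
  obtain ⟨c, hcs, hceq⟩ := exists_hasDerivAt_eq_slope u u' (by linarith : s - η < s)
    (fun x hx => (hc x (ha0.trans_le hx.1)).continuousWithinAt)
    (fun x hx => hu x (ha0.trans hx.1))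
  have hc0 : 0 < c := ha0.trans hcs.1
  obtain ⟨d, hds, hdeq⟩ := exists_hasDerivAt_eq_slope (fun t => t * u' t) _ hcs.2
    (fun x hx => (hg x (hc0.trans_le hx.1)).continuousAt.continuousWithinAt)
    (fun x hx => hg x (hc0.trans hx.1))
  have hd0 : 0 < d := hc0.trans hds.1
  have hud : u (s - η) ≤ u d :=
    hmono ⟨ha0, by linarith⟩ ⟨hd0, hds.2.le⟩ (hcs.1.trans hds.1).le
  have hud0 := hnonpos d hd0
  have hexp := exp_sub_exp_neg_le (x := -(u d) / 2) (by linarith) (by linarith)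
  rw [show -(-(u d) / 2) = u d / 2 by ring] at hexp
  rw [eq_div_iff (by linarith), hus, show s - (s - η) = η by ring] at hceq
  simp only [hs', mul_zero] at hdeq
  rw [eq_div_iff (by linarith [hcs.2])] at hdeq
  set m := -u (s - η) with hmdef
  have hm0 : 0 < m := by linarith
  have h1 : c * u' c ≤ η * (s * (2 * m)) := by
    have e : c * u' c
        = (s - c) * (d * (Real.exp (-(u d) / 2) - Real.exp (u d / 2))) := by linarith
    rw [e]
    have h2 : Real.exp (-(u d) / 2) - Real.exp (u d / 2) ≤ 2 * m := by linarith
    have h3 : 0 ≤ Real.exp (-(u d) / 2) - Real.exp (u d / 2) :=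
      sub_nonneg.2 (Real.exp_le_exp.2 (by linarith))
    have h4 : s - c ≤ η := by linarith [hcs.1]
    have h5 : d ≤ s := hds.2.le
    gcongr
  have h6 : c * m = c * u' c * η := by rw [mul_assoc, hceq]; ring
  have h7 : s / 2 * m < c * m := by
    have : s / 2 < c := by linarith [hcs.1]
    gcongr
  have h8 : c * u' c * η ≤ η * (s * (2 * m)) * η := by gcongr
  have h9 : η * (s * (2 * m)) * η ≤ 1 / 4 * (s * (2 * m)) * (1 / 4) := by gcongr
  nlinarith [mul_pos hs0 hm0]

theorem sinhGordon_ru'_strictAnti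
    (N : ℕ) (hN : 0 < N) (u u' u'' : ℝ → ℝ)
    (hder1 : ∀ r ∈ Set.Ioi (0:ℝ), HasDerivAt u (u' r) r)
    (hder2 : ∀ r ∈ Set.Ioi (0:ℝ), HasDerivAt u' (u'' r) r)
    (hcont : ContinuousOn u'' (Set.Ioi (0:ℝ)))
    (hne : ∃ r ∈ Set.Ioi (0:ℝ), u r ≠ 0)
    (hODE : ∀ r ∈ Set.Ioi (0:ℝ),
      u'' r + u' r / r = Real.exp (u r / 2) - Real.exp (-(u r) / 2))
    (hlim0 : Filter.Tendsto (fun r => r * u' r) (nhdsWithin 0 (Set.Ioi 0))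
      (nhds (4 * (N:ℝ) / ((N:ℝ) + 2))))
    (hbot : Filter.Tendsto u (nhdsWithin 0 (Set.Ioi 0)) Filter.atBot)
    (htop : Filter.Tendsto u Filter.atTop (nhds 0)) :
    (∀ r ∈ Set.Ioi (0:ℝ), HasDerivAt (fun t => t * u' t)
      (r * (Real.exp (u r / 2) - Real.exp (-(u r) / 2))) r) ∧
    StrictAntiOn (fun r => r * u' r) (Set.Ioi (0:ℝ)) ∧
    ∀ r ∈ Set.Ioi (0:ℝ), 0 < r * u' r ∧ r * u' r < 4 * (N:ℝ) / ((N:ℝ) + 2) := by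
  have hg : ∀ r ∈ Set.Ioi (0:ℝ), HasDerivAt (fun t => t * u' t)
      (r * (Real.exp (u r / 2) - Real.exp (-(u r) / 2))) r := by
    intro r hr
    have hr0 : r ≠ 0 := ne_of_gt hr
    refine ((hasDerivAt_id r).mul (hder2 r hr)).congr_deriv ?_
    rw [← hODE r hr]
    simp only [id]
    field_simp
    ring
  have hneg := sinhGordon_neg hder1 hg hbot (sinhGordon_nonpos hder1 hg hbot htop)
  have hanti : StrictAntiOn (fun r => r * u' r) (Set.Ioi (0:ℝ)) := by
    refine strictAntiOn_of_hasDerivWithinAt_neg (convex_Ioi _)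
      (fun x hx => (hg x hx).continuousAt.continuousWithinAt)
      (fun x hx => (hg x (interior_subset hx)).hasDerivWithinAt) fun x hx => ?_
    have hx' := interior_subset hx
    have := hneg x hx'
    exact mul_neg_of_pos_of_neg hx' (sub_neg.2 (Real.exp_lt_exp.2 (by linarith)))
  refine ⟨hg, hanti, fun r hr => ⟨?_, ?_⟩⟩
  · by_contra! hle
    have hr0 : 0 < r := hr
    have hu : AntitoneOn u (Set.Ici r) := by
      refine antitoneOn_of_hasDerivWithinAt_nonpos (convex_Ici _)
        (fun x hx => (hder1 x (hr0.trans_le hx)).continuousAt.continuousWithinAt)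
        (fun x hx => (hder1 x (hr0.trans_le (interior_subset hx))).hasDerivWithinAt)
        fun x hx => ?_
      have hrx : r ≤ x := interior_subset hx
      have hx0 : 0 < x := hr0.trans_le hrx
      have h : x * u' x ≤ r * u' r := hanti.antitoneOn hr hx0 hrx
      exact nonpos_of_mul_nonpos_right (h.trans hle) hx0
    have : (0:ℝ) ≤ u r := le_of_tendsto htop (by
      filter_upwards [Filter.eventually_ge_atTop r] with x hx using hu Set.self_mem_Ici hx hx)
    linarith [hneg r hr]
  · have hr0 : 0 < r := hr
    have hr2 : 0 < r / 2 := by positivity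
    have h : r * u' r < r / 2 * u' (r / 2) := hanti hr2 hr (by linarith)
    refine h.trans_le (ge_of_tendsto hlim0 ?_)
    filter_upwards [Ioo_mem_nhdsGT hr2] with x hx using hanti.antitoneOn hx.1 hr2 hx.2.le
end

section
/- Let u be as in the context (a radial solution of the Sinh–Gordon equation describing an N-vortex). Then the surface with metric e^{−u/2}(dr² + r² dθ²) admits an isometric embedding in ℝ³ as a surface of revolution away from r = 0: there exist continuously differentiable functions ρ, z : (0,∞) → ℝ with ρ(r) = e^{−u(r)/4}·r and ρ'(r)² + z'(r)² = e^{−u(r)/2} for all r ∈ (0, ∞). -/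
open Set Filter Topology

/-- A continuous function on `(0, ∞)` which tends to `-∞` at `0` and to `0` at `∞`, and takes a
positive value, attains its maximum. -/
lemma exists_isMaxOn_Ioi_of_tendsto {u : ℝ → ℝ} (hu : ContinuousOn u (Ioi 0))
    (hbot : Tendsto u (𝓝[>] 0) atBot) (htop : Tendsto u atTop (𝓝 0))
    {r : ℝ} (hr : 0 < r) (hpos : 0 < u r) : ∃ m, 0 < m ∧ 0 < u m ∧ ∀ x, 0 < x → u x ≤ u m := by
  obtain ⟨a, ha, hau⟩ :=
    mem_nhdsGT_iff_exists_Ioo_subset.1 (hbot.eventually (eventually_lt_atBot (u r)))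
  obtain ⟨b, hbu⟩ := eventually_atTop.1 (htop.eventually (gt_mem_nhds hpos))
  have ha0 : (0 : ℝ) < a := ha
  have har : a ≤ r := by
    by_contra! h
    exact lt_irrefl (u r) (hau ⟨hr, h⟩)
  have hrb : r ≤ b := by
    by_contra! h
    exact lt_irrefl (u r) (hbu r h.le)
  obtain ⟨m, hm, hmax⟩ := isCompact_Icc.exists_isMaxOn ⟨r, har, hrb⟩
    (hu.mono fun x (hx : x ∈ Icc a b) => ha0.trans_le hx.1)
  have hrm : u r ≤ u m := hmax ⟨har, hrb⟩
  refine ⟨m, ha0.trans_le hm.1, hpos.trans_le hrm, fun x hx => ?_⟩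
  rcases lt_or_ge x a with hxa | hxa
  · exact (hau ⟨hx, hxa⟩ : u x < u r).le.trans hrm
  rcases le_or_gt b x with hxb | hxb
  · exact (hbu x hxb).le.trans hrm
  · exact hmax ⟨hxa, hxb.le⟩

/-- The radial Sinh–Gordon equation in divergence form. -/
lemma hasDerivAt_mul_deriv_of_sinhGordon {u u' u'' : ℝ → ℝ} {r : ℝ} (hr : 0 < r)
    (hder2 : HasDerivAt u' (u'' r) r)
    (hODE : u'' r + u' r / r = Real.exp (u r / 2) - Real.exp (-(u r) / 2)) :
    HasDerivAt (fun r => r * u' r)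
      (r * (Real.exp (u r / 2) - Real.exp (-(u r) / 2))) r := by
  refine ((hasDerivAt_id' r).mul hder2).congr_deriv ?_
  rw [← hODE]
  field_simp
  ring

/-- Maximum principle: a radial solution of the Sinh–Gordon equation which tends to `-∞` at `0`
and to `0` at `∞` is nonpositive. -/
lemma nonpos_of_sinhGordon {u u' : ℝ → ℝ} (hder : ∀ r, 0 < r → HasDerivAt u (u' r) r)
    (hw : ∀ r, 0 < r → HasDerivAt (fun r => r * u' r)
      (r * (Real.exp (u r / 2) - Real.exp (-(u r) / 2))) r)
    (hbot : Tendsto u (𝓝[>] 0) atBot) (htop : Tendsto u atTop (𝓝 0))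
    {r : ℝ} (hr : 0 < r) : u r ≤ 0 := by
  by_contra! hpos
  obtain ⟨m, hm, hum, hmax⟩ := exists_isMaxOn_Ioi_of_tendsto
    (fun x hx => (hder x hx).continuousAt.continuousWithinAt) hbot htop hr hpos
  have hu'm : u' m = 0 := by
    refine IsLocalMax.hasDerivAt_eq_zero ?_ (hder m hm)
    filter_upwards [lt_mem_nhds hm] with x hx using hmax x hx
  have hw'm : 0 < m * (Real.exp (u m / 2) - Real.exp (-(u m) / 2)) :=
    mul_pos hm (sub_pos.2 (Real.exp_lt_exp.2 (by linarith)))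
  have hslope := (hasDerivAt_iff_tendsto_slope.1 (hw m hm)).mono_left
    (nhdsWithin_mono m fun x (hx : x ∈ Ioi m) => (ne_of_gt hx : x ≠ m))
  obtain ⟨b, hb, hbpos⟩ :=
    mem_nhdsGT_iff_exists_Ioo_subset.1 (hslope.eventually (lt_mem_nhds hw'm))
  have hu'pos : ∀ x ∈ Ioo m b, 0 < u' x := by
    intro x hx
    have h : 0 < slope (fun r => r * u' r) m x := hbpos hx
    rw [slope_def_field, hu'm, mul_zero, sub_zero] at h
    have hxm : 0 < x - m := sub_pos.2 hx.1
    exact pos_of_mul_pos_right ((div_pos_iff_of_pos_right hxm).1 h) (hm.trans hx.1).le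
  obtain ⟨c, hmc, hcb⟩ := exists_between (show m < b from hb)
  have hmono : StrictMonoOn u (Icc m c) := by
    refine strictMonoOn_of_deriv_pos (convex_Icc m c)
      (fun x hx => (hder x (hm.trans_le hx.1)).continuousAt.continuousWithinAt) fun x hx => ?_
    rw [interior_Icc] at hx
    rw [(hder x (hm.trans hx.1)).deriv]
    exact hu'pos x ⟨hx.1, hx.2.trans hcb⟩
  exact (hmono (left_mem_Icc.2 hmc.le) (right_mem_Icc.2 hmc.le) hmc).not_ge
    (hmax c (hm.trans hmc))

/-- For a nonpositive solution `u` with `u → 0` at infinity, the flux `r u'(r)` is nonnegative. -/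
lemma mul_deriv_nonneg_of_antitoneOn {u u' : ℝ → ℝ}
    (hder : ∀ r, 0 < r → HasDerivAt u (u' r) r) (hanti : AntitoneOn (fun r => r * u' r) (Ioi 0))
    (hu : ∀ r, 0 < r → u r ≤ 0) (htop : Tendsto u atTop (𝓝 0)) {r : ℝ} (hr : 0 < r) :
    0 ≤ r * u' r := by
  by_contra! hneg
  have hu'neg : ∀ x, r ≤ x → u' x < 0 := by
    intro x hx
    have hx0 : 0 < x := hr.trans_le hx
    have h : x * u' x ≤ r * u' r := hanti hr hx0 hx
    exact neg_of_mul_neg_right (h.trans_lt hneg) hx0.le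
  have hstrict : StrictAntiOn u (Ici r) := by
    refine strictAntiOn_of_deriv_neg (convex_Ici r)
      (fun x hx => (hder x (hr.trans_le hx)).continuousAt.continuousWithinAt) fun x hx => ?_
    rw [interior_Ici] at hx
    rw [(hder x (hr.trans hx)).deriv]
    exact hu'neg x (le_of_lt hx)
  have hr1 : r < r + 1 := lt_add_one r
  have hlt : u (r + 1) < 0 := (hstrict self_mem_Ici hr1.le hr1).trans_le (hu r hr)
  refine hlt.not_ge (le_of_tendsto htop ?_)
  filter_upwards [eventually_ge_atTop (r + 1)] with x hx
  exact hstrict.antitoneOn hr1.le (hr1.le.trans hx) hx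

/-- A function continuous on `(0, ∞)` has a primitive there. -/
lemma exists_hasDerivAt_of_continuousOn_Ioi {f : ℝ → ℝ} (hf : ContinuousOn f (Ioi 0)) :
    ∃ F : ℝ → ℝ, ∀ r ∈ Ioi (0 : ℝ), HasDerivAt F (f r) r := by
  refine ⟨fun r => ∫ t in (1 : ℝ)..r, f t, fun r hr => ?_⟩
  refine intervalIntegral.integral_hasDerivAt_right ?_
    (hf.stronglyMeasurableAtFilter isOpen_Ioi r hr) (hf.continuousAt (Ioi_mem_nhds hr))
  refine (hf.mono fun x hx => ?_).intervalIntegrable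
  exact (lt_min one_pos hr).trans_le hx.1

theorem sinhGordon_euclidean_embedding
    (N : ℕ) (hN : 0 < N) (u u' u'' : ℝ → ℝ)
    (hder1 : ∀ r ∈ Set.Ioi (0:ℝ), HasDerivAt u (u' r) r)
    (hder2 : ∀ r ∈ Set.Ioi (0:ℝ), HasDerivAt u' (u'' r) r)
    (hcont : ContinuousOn u'' (Set.Ioi (0:ℝ)))
    (hne : ∃ r ∈ Set.Ioi (0:ℝ), u r ≠ 0)
    (hODE : ∀ r ∈ Set.Ioi (0:ℝ),
      u'' r + u' r / r = Real.exp (u r / 2) - Real.exp (-(u r) / 2))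
    (hlim0 : Filter.Tendsto (fun r => r * u' r) (nhdsWithin 0 (Set.Ioi 0))
      (nhds (4 * (N:ℝ) / ((N:ℝ) + 2))))
    (hbot : Filter.Tendsto u (nhdsWithin 0 (Set.Ioi 0)) Filter.atBot)
    (htop : Filter.Tendsto u Filter.atTop (nhds 0)) :
    ∃ ρ z ρ' z' : ℝ → ℝ,
      (∀ r ∈ Set.Ioi (0:ℝ), HasDerivAt ρ (ρ' r) r) ∧
      (∀ r ∈ Set.Ioi (0:ℝ), HasDerivAt z (z' r) r) ∧
      ContinuousOn ρ' (Set.Ioi (0:ℝ)) ∧ ContinuousOn z' (Set.Ioi (0:ℝ)) ∧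
      (∀ r ∈ Set.Ioi (0:ℝ), ρ r = Real.exp (-(u r) / 4) * r) ∧
      (∀ r ∈ Set.Ioi (0:ℝ), ρ' r ^ 2 + z' r ^ 2 = Real.exp (-(u r) / 2)) := by
  have hw : ∀ r, 0 < r → HasDerivAt (fun r => r * u' r)
      (r * (Real.exp (u r / 2) - Real.exp (-(u r) / 2))) r := fun r hr =>
    hasDerivAt_mul_deriv_of_sinhGordon hr (hder2 r hr) (hODE r hr)
  have hu : ∀ r, 0 < r → u r ≤ 0 := fun r hr => nonpos_of_sinhGordon hder1 hw hbot htop hr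
  have hanti : AntitoneOn (fun r => r * u' r) (Ioi 0) := by
    refine antitoneOn_of_deriv_nonpos (convex_Ioi 0)
      (fun x hx => (hw x hx).continuousAt.continuousWithinAt)
      (fun x hx => (hw x (interior_subset hx)).differentiableAt.differentiableWithinAt)
      fun x hx => ?_
    have hx0 : 0 < x := interior_subset hx
    rw [(hw x hx0).deriv]
    exact mul_nonpos_of_nonneg_of_nonpos hx0.le
      (sub_nonpos.2 (Real.exp_le_exp.2 (by linarith [hu x hx0])))
  have hlow : ∀ r, 0 < r → 0 ≤ r * u' r := fun r hr =>
    mul_deriv_nonneg_of_antitoneOn hder1 hanti hu htop hr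
  have hupp : ∀ r, 0 < r → r * u' r ≤ 4 := by
    intro r hr
    have h : r * u' r ≤ 4 * (N : ℝ) / ((N : ℝ) + 2) := by
      refine ge_of_tendsto hlim0 ?_
      filter_upwards [Ioo_mem_nhdsGT hr] with x hx
      exact hanti hx.1 hr hx.2.le
    refine h.trans ((div_le_iff₀ (by positivity)).2 (by linarith))
  have hcu : ContinuousOn u (Ioi 0) :=
    fun r hr => (hder1 r hr).continuousAt.continuousWithinAt
  have hcu' : ContinuousOn u' (Ioi 0) :=
    fun r hr => (hder2 r hr).continuousAt.continuousWithinAt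
  have hcz : ContinuousOn
      (fun r => Real.exp (-(u r) / 4) * √(1 - (1 - r * u' r / 4) ^ 2)) (Ioi 0) := by
    fun_prop
  obtain ⟨z, hz⟩ := exists_hasDerivAt_of_continuousOn_Ioi hcz
  refine ⟨fun r => Real.exp (-(u r) / 4) * r, z,
    fun r => Real.exp (-(u r) / 4) * (1 - r * u' r / 4), _, fun r hr => ?_, hz, ?_, hcz,
    fun _ _ => rfl, fun r hr => ?_⟩
  · refine (((hder1 r hr).fun_neg.div_const 4).exp.mul (hasDerivAt_id' r)).congr_deriv ?_
    ring
  · fun_prop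
  · have h0 := hlow r hr
    have h4 := hupp r hr
    have hexp : Real.exp (-(u r) / 2) = Real.exp (-(u r) / 4) ^ 2 := by
      rw [← Real.exp_nat_mul]
      congr 1
      push_cast
      ring
    rw [mul_pow, mul_pow, Real.sq_sqrt (by nlinarith), hexp]
    ring
end

section
/- Let L > 0 and let f : I → ℝ be a positive continuously differentiable function on an interval I ⊆ (0,∞) such that L²(1 − f'(r)²) + f(r)² ≥ 0 for all r ∈ I. Fix r₀ ∈ I and define, for either choice of sign, z(r) = exp( ∫_{r₀}^{r} (−f(t)f'(t) ± √(L²(1 − f'(t)²) + f(t)²)) / (L² + f(t)²) dt ) and ρ(r) = z(r)f(r)/L. Then z(r) > 0 for all r ∈ I, and the pair (z, ρ) satisfies L²·(z'(r)² + ρ'(r)²)/z(r)² = 1 and L·ρ(r)/z(r) = f(r) for all r ∈ I; i.e., the pullback of the upper half-space hyperbolic metric L²(dz² + dρ² + ρ²dψ²)/z² under the surface of revolution (r, ψ) ↦ (z(r), ρ(r), ψ) equals dr² + f(r)² dψ². -/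
/-- The fundamental theorem of calculus on an open interval, for a continuous integrand. -/
theorem hasDerivAt_integral_of_continuousOn {I : Set ℝ} (hI : IsOpen I) (hord : I.OrdConnected)
    {g : ℝ → ℝ} (hg : ContinuousOn g I) {a r : ℝ} (ha : a ∈ I) (hr : r ∈ I) :
    HasDerivAt (fun x => ∫ t in a..x, g t) (g r) r :=
  intervalIntegral.integral_hasDerivAt_right
    (hg.mono (hord.uIcc_subset ha hr)).intervalIntegrable
    (hg.stronglyMeasurableAtFilter hI r hr) (hg.continuousAt (hI.mem_nhds hr))

/-- The logarithmic derivative of the profile solves the quadratic equation expressing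
arc-length parametrisation. -/
theorem profile_quadratic {L x y ε : ℝ} (hL : 0 < L) (hε : ε = 1 ∨ ε = -1)
    (h : 0 ≤ L ^ 2 * (1 - y ^ 2) + x ^ 2) :
    let u := (-(x * y) + ε * Real.sqrt (L ^ 2 * (1 - y ^ 2) + x ^ 2)) / (L ^ 2 + x ^ 2)
    L ^ 2 * u ^ 2 + (u * x + y) ^ 2 = 1 := by
  intro u
  have hpos : 0 < L ^ 2 + x ^ 2 := by positivity
  have hu : u * (L ^ 2 + x ^ 2) =
      -(x * y) + ε * Real.sqrt (L ^ 2 * (1 - y ^ 2) + x ^ 2) := div_mul_cancel₀ _ hpos.ne'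
  have hs := Real.sq_sqrt h
  have hε2 : ε ^ 2 = 1 := by rcases hε with rfl | rfl <;> norm_num
  have hsq : (u * (L ^ 2 + x ^ 2) + x * y) ^ 2 = L ^ 2 * (1 - y ^ 2) + x ^ 2 := by
    rw [hu, neg_add_cancel_comm, mul_pow, hε2, hs, one_mul]
  apply mul_left_cancel₀ hpos.ne'
  linear_combination hsq

theorem hyperbolic_embedding_surface_of_revolution
    (L : ℝ) (hL : 0 < L) (I : Set ℝ) (hIopen : IsOpen I)
    (hIord : I.OrdConnected) (hIsub : I ⊆ Set.Ioi (0:ℝ))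
    (f f' : ℝ → ℝ)
    (hfpos : ∀ r ∈ I, 0 < f r)
    (hfder : ∀ r ∈ I, HasDerivAt f (f' r) r)
    (hf'cont : ContinuousOn f' I)
    (hineq : ∀ r ∈ I, 0 ≤ L ^ 2 * (1 - f' r ^ 2) + f r ^ 2)
    (r₀ : ℝ) (hr₀ : r₀ ∈ I)
    (ε : ℝ) (hε : ε = 1 ∨ ε = -1)
    (z ρ : ℝ → ℝ)
    (hz : ∀ r, z r = Real.exp (∫ t in r₀..r,
      (-(f t * f' t) + ε * Real.sqrt (L ^ 2 * (1 - f' t ^ 2) + f t ^ 2)) /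
        (L ^ 2 + f t ^ 2)))
    (hρ : ∀ r, ρ r = z r * f r / L) :
    (∀ r ∈ I, 0 < z r) ∧
    ∃ z' ρ' : ℝ → ℝ,
      (∀ r ∈ I, HasDerivAt z (z' r) r) ∧
      (∀ r ∈ I, HasDerivAt ρ (ρ' r) r) ∧
      ∀ r ∈ I, L ^ 2 * (z' r ^ 2 + ρ' r ^ 2) / z r ^ 2 = 1 ∧
        L * ρ r / z r = f r := by
  have hf : ContinuousOn f I := fun r hr => (hfder r hr).continuousAt.continuousWithinAt
  set u : ℝ → ℝ := fun t =>
    (-(f t * f' t) + ε * Real.sqrt (L ^ 2 * (1 - f' t ^ 2) + f t ^ 2)) / (L ^ 2 + f t ^ 2)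
  have hucont : ContinuousOn u I := by
    refine ContinuousOn.div (by fun_prop) (by fun_prop) fun t _ => ?_
    positivity
  have hzpos : ∀ r, 0 < z r := fun r => hz r ▸ Real.exp_pos _
  have hzder : ∀ r ∈ I, HasDerivAt z (z r * u r) r := fun r hr => by
    rw [hz r, funext hz]
    exact (hasDerivAt_integral_of_continuousOn hIopen hIord hucont hr₀ hr).exp
  refine ⟨fun r _ => hzpos r, fun r => z r * u r,
    fun r => (z r * u r * f r + z r * f' r) / L, hzder, fun r hr => ?_, fun r hr => ⟨?_, ?_⟩⟩
  · rw [funext hρ]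
    exact ((hzder r hr).mul (hfder r hr)).div_const L
  · have hzr := (hzpos r).ne'
    have hq : L ^ 2 * u r ^ 2 + (u r * f r + f' r) ^ 2 = 1 :=
      profile_quadratic hL hε (hineq r hr)
    clear_value u
    field_simp
    linear_combination hq
  · have hzr := (hzpos r).ne'
    rw [hρ]
    field_simp
end

section
/- Let u be as in the context (a radial solution of the Sinh–Gordon equation describing an N-vortex), let L > 0, and define P(r) = 16r²e^{−u(r)/2}(N+2)² − L²((N+2)r·u'(r) − 4N)((N+2)r·u'(r) − 4N − 16). Then P is differentiable on (0,∞) and P'(r) = 2r(N+2)²(L²e^{u(r)/2} + (4 − L²)e^{−u(r)/2})(4 − r·u'(r)) for all r ∈ (0, ∞). -/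
theorem sinhGordon_P_derivative
    (N : ℕ) (hN : 0 < N) (u u' u'' : ℝ → ℝ)
    (hder1 : ∀ r ∈ Set.Ioi (0:ℝ), HasDerivAt u (u' r) r)
    (hder2 : ∀ r ∈ Set.Ioi (0:ℝ), HasDerivAt u' (u'' r) r)
    (hcont : ContinuousOn u'' (Set.Ioi (0:ℝ)))
    (hne : ∃ r ∈ Set.Ioi (0:ℝ), u r ≠ 0)
    (hODE : ∀ r ∈ Set.Ioi (0:ℝ),
      u'' r + u' r / r = Real.exp (u r / 2) - Real.exp (-(u r) / 2))
    (hlim0 : Filter.Tendsto (fun r => r * u' r) (nhdsWithin 0 (Set.Ioi 0))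
      (nhds (4 * (N:ℝ) / ((N:ℝ) + 2))))
    (hbot : Filter.Tendsto u (nhdsWithin 0 (Set.Ioi 0)) Filter.atBot)
    (htop : Filter.Tendsto u Filter.atTop (nhds 0))
    (L : ℝ) (hL : 0 < L) (P : ℝ → ℝ)
    (hP : ∀ r, P r = 16 * r ^ 2 * Real.exp (-(u r) / 2) * ((N:ℝ) + 2) ^ 2 -
      L ^ 2 * (((N:ℝ) + 2) * r * u' r - 4 * (N:ℝ)) *
        (((N:ℝ) + 2) * r * u' r - 4 * (N:ℝ) - 16)) :
    ∀ r ∈ Set.Ioi (0:ℝ), HasDerivAt P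
      (2 * r * ((N:ℝ) + 2) ^ 2 *
        (L ^ 2 * Real.exp (u r / 2) + (4 - L ^ 2) * Real.exp (-(u r) / 2)) *
        (4 - r * u' r)) r := by
  intro r hr
  have hr0 : r ≠ 0 := (Set.mem_Ioi.mp hr).ne'
  have hODE' : r * u'' r + u' r = r * (Real.exp (u r / 2) - Real.exp (-(u r) / 2)) := by
    rw [← hODE r hr]
    field_simp
  have hexp : HasDerivAt (fun x => Real.exp (-(u x) / 2))
      (Real.exp (-(u r) / 2) * (-(u' r) / 2)) r :=
    ((hder1 r hr).fun_neg.div_const 2).exp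
  have hlin : HasDerivAt (fun x => ((N:ℝ) + 2) * x * u' x - 4 * (N:ℝ))
      (((N:ℝ) + 2) * 1 * u' r + ((N:ℝ) + 2) * r * u'' r) r :=
    (((hasDerivAt_id' r).const_mul ((N:ℝ) + 2)).fun_mul (hder2 r hr)).sub_const _
  have hfst := ((((hasDerivAt_id' r).fun_pow 2).const_mul 16).fun_mul hexp).mul_const
    (((N:ℝ) + 2) ^ 2)
  have hsnd := (hlin.const_mul (L ^ 2)).fun_mul (hlin.sub_const 16)
  rw [funext hP]
  refine (hfst.fun_sub hsnd).congr_deriv ?_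
  push_cast
  linear_combination
    2 * L ^ 2 * ((N:ℝ) + 2) ^ 2 * (4 - r * u' r) * hODE'
end

section
/- Let u be as in the context (a radial solution of the Sinh–Gordon equation describing an N-vortex) and let L > 0 with L² ≤ 4. Then the regular N-vortex surface with metric e^{−u/2}(dr² + ((N+2)/2)² r² dψ²) admits an isometric embedding as a surface of revolution in hyperbolic 3-space of Ricci scalar −6/L²: there exist continuously differentiable functions z, ρ : (0,∞) → ℝ with z(r) > 0, satisfying L·ρ(r)/z(r) = ((N+2)/2)·r·e^{−u(r)/4} and L²·(z'(r)² + ρ'(r)²)/z(r)² = e^{−u(r)/2} for all r ∈ (0, ∞). -/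
open Set Filter Topology

/-- A continuous function on `(0, ∞)` has an antiderivative there. -/
lemma ContinuousOn.exists_hasDerivAt_Ioi {w : ℝ → ℝ} (hw : ContinuousOn w (Ioi 0)) :
    ∃ W : ℝ → ℝ, ∀ r ∈ Ioi (0 : ℝ), HasDerivAt W (w r) r := by
  refine ⟨fun r => ∫ t in (1 : ℝ)..r, w t, fun r hr => ?_⟩
  have hsub : uIcc 1 r ⊆ Ioi (0 : ℝ) :=
    ordConnected_Ioi.uIcc_subset (mem_Ioi.2 one_pos) hr
  exact intervalIntegral.integral_hasDerivAt_right (hw.mono hsub).intervalIntegrable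
    (hw.stronglyMeasurableAtFilter isOpen_Ioi r hr) (hw.continuousAt (Ioi_mem_nhds hr))

/-- A pair `(z, ρ)` with prescribed quotient `ρ / z = g` and prescribed scaled arc length
`(z' ^ 2 + ρ' ^ 2) / z ^ 2 = h` exists as soon as `g' ^ 2 ≤ h * (1 + g ^ 2)`. -/
lemma exists_profile_of_sq_le {g g' h : ℝ → ℝ}
    (hg : ∀ r ∈ Ioi (0 : ℝ), HasDerivAt g (g' r) r)
    (hg' : ContinuousOn g' (Ioi 0)) (hh : ContinuousOn h (Ioi 0))
    (hle : ∀ r ∈ Ioi (0 : ℝ), g' r ^ 2 ≤ h r * (1 + g r ^ 2)) :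
    ∃ z ρ z' ρ' : ℝ → ℝ,
      (∀ r ∈ Ioi (0 : ℝ), HasDerivAt z (z' r) r) ∧
      (∀ r ∈ Ioi (0 : ℝ), HasDerivAt ρ (ρ' r) r) ∧
      ContinuousOn z' (Ioi 0) ∧ ContinuousOn ρ' (Ioi 0) ∧
      (∀ r, 0 < z r) ∧ (∀ r, ρ r / z r = g r) ∧
      (∀ r ∈ Ioi (0 : ℝ), (z' r ^ 2 + ρ' r ^ 2) / z r ^ 2 = h r) := by
  have hgc : ContinuousOn g (Ioi 0) := fun r hr => (hg r hr).continuousAt.continuousWithinAt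
  have hpos : ∀ r, 0 < 1 + g r ^ 2 := fun r => by positivity
  obtain ⟨w, hw⟩ : ∃ w : ℝ → ℝ, w = fun r =>
      (-(g r * g' r) + √(h r * (1 + g r ^ 2) - g' r ^ 2)) / (1 + g r ^ 2) := ⟨_, rfl⟩
  have hwc : ContinuousOn w (Ioi 0) := by
    rw [hw]
    exact ContinuousOn.div (by fun_prop) (by fun_prop) fun r _ => (hpos r).ne'
  have hquad : ∀ r ∈ Ioi (0 : ℝ), w r ^ 2 + (g' r + g r * w r) ^ 2 = h r := by
    intro r hr
    have hs := Real.sq_sqrt (sub_nonneg.2 (hle r hr))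
    have hr' := (hpos r).ne'
    simp only [hw]
    set s := √(h r * (1 + g r ^ 2) - g' r ^ 2)
    field_simp
    linear_combination (1 + g r ^ 2) * hs
  obtain ⟨W, hW⟩ := hwc.exists_hasDerivAt_Ioi
  have hz : ∀ r ∈ Ioi (0 : ℝ),
      HasDerivAt (fun r => Real.exp (W r)) (Real.exp (W r) * w r) r := fun r hr => (hW r hr).exp
  have hzc : ContinuousOn (fun r => Real.exp (W r)) (Ioi 0) :=
    fun r hr => (hz r hr).continuousAt.continuousWithinAt
  refine ⟨fun r => Real.exp (W r), fun r => g r * Real.exp (W r), _,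
    fun r => g' r * Real.exp (W r) + g r * (Real.exp (W r) * w r), hz,
    fun r hr => (hg r hr).mul (hz r hr), hzc.mul hwc, (hg'.mul hzc).add (hgc.mul (hzc.mul hwc)),
    fun r => Real.exp_pos _, fun r => ?_, fun r hr => ?_⟩
  · exact mul_div_cancel_right₀ _ (Real.exp_ne_zero _)
  · have := Real.exp_ne_zero (W r)
    rw [← hquad r hr]
    field_simp

/-- At a point where the derivative vanishes and the second derivative is positive there is no
local maximum. -/
lemma not_isLocalMax_of_hasDerivAt_pos {u u' : ℝ → ℝ} {x c : ℝ}
    (hu : ∀ᶠ y in 𝓝 x, HasDerivAt u (u' y) y) (hu' : HasDerivAt u' c x) (hc : 0 < c) :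
    ¬ IsLocalMax u x := by
  intro hmax
  have hderiv : deriv u =ᶠ[𝓝 x] u' := hu.mono fun y hy => hy.deriv
  have hdd : deriv (deriv u) x = c := hderiv.deriv_eq.trans hu'.deriv
  have hmin : IsLocalMin u x := isLocalMin_of_deriv_deriv_pos (hdd ▸ hc)
    hmax.deriv_eq_zero hu.self_of_nhds.continuousAt
  have hconst : u =ᶠ[𝓝 x] fun _ => u x := by
    filter_upwards [hmax, hmin] with y h₁ h₂ using le_antisymm h₁ h₂
  have : deriv (deriv u) x = 0 := by
    rw [hconst.deriv.deriv_eq]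
    simp
  exact hc.ne' (hdd ▸ this)

section SinhGordon

variable {u'' u' u : ℝ → ℝ}

/-- Maximum principle for the radial Sinh–Gordon equation. -/
lemma sinhGordon_nonpos_s10
    (hder1 : ∀ r ∈ Ioi (0 : ℝ), HasDerivAt u (u' r) r)
    (hder2 : ∀ r ∈ Ioi (0 : ℝ), HasDerivAt u' (u'' r) r)
    (hODE : ∀ r ∈ Ioi (0 : ℝ), u'' r + u' r / r = Real.exp (u r / 2) - Real.exp (-(u r) / 2))
    (hbot : Tendsto u (𝓝[>] 0) atBot) (htop : Tendsto u atTop (𝓝 0)) :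
    ∀ r ∈ Ioi (0 : ℝ), u r ≤ 0 := by
  intro r hr
  by_contra! hpos
  obtain ⟨a, ha, ha0, har⟩ : ∃ a, u a < u r ∧ 0 < a ∧ a < r :=
    ((hbot.eventually_lt_atBot (u r)).and (Ioo_mem_nhdsGT hr)).exists
  obtain ⟨b, hb, hrb⟩ : ∃ b, u b < u r ∧ r < b :=
    ((htop.eventually_lt_const hpos).and (eventually_gt_atTop r)).exists
  have hsub : Icc a b ⊆ Ioi 0 := fun x hx => ha0.trans_le hx.1
  obtain ⟨x, hx, hmax⟩ := isCompact_Icc.exists_isMaxOn (nonempty_Icc.2 (har.trans hrb).le)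
    fun y hy => (hder1 y (hsub hy)).continuousAt.continuousWithinAt
  have hrx : u r ≤ u x := hmax ⟨har.le, hrb.le⟩
  have hxa : a < x := hx.1.lt_of_ne fun h => by subst h; linarith
  have hxb : x < b := hx.2.lt_of_ne fun h => by subst h; linarith
  have hx0 : x ∈ Ioi (0 : ℝ) := hsub hx
  have hloc : IsLocalMax u x := hmax.isLocalMax (Icc_mem_nhds hxa hxb)
  have hu'0 : u' x = 0 := hloc.hasDerivAt_eq_zero (hder1 x hx0)
  have hu''pos : 0 < u'' x := by
    have h := hODE x hx0
    rw [hu'0, zero_div, add_zero] at h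
    rw [h, sub_pos, Real.exp_lt_exp]
    linarith
  exact not_isLocalMax_of_hasDerivAt_pos (eventually_of_mem (Ioi_mem_nhds hx0) hder1)
    (hder2 x hx0) hu''pos hloc

lemma sinhGordon_hasDerivAt_mul_deriv
    (hder2 : ∀ r ∈ Ioi (0 : ℝ), HasDerivAt u' (u'' r) r)
    (hODE : ∀ r ∈ Ioi (0 : ℝ), u'' r + u' r / r = Real.exp (u r / 2) - Real.exp (-(u r) / 2))
    {r : ℝ} (hr : r ∈ Ioi (0 : ℝ)) :
    HasDerivAt (fun r => r * u' r) (r * (Real.exp (u r / 2) - Real.exp (-(u r) / 2))) r := by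
  have hr0 : r ≠ 0 := (mem_Ioi.1 hr).ne'
  refine ((hasDerivAt_id r).mul (hder2 r hr)).congr_deriv ?_
  rw [← hODE r hr]
  simp only [id]
  field_simp
  ring

lemma sinhGordon_mul_deriv_le
    (hder1 : ∀ r ∈ Ioi (0 : ℝ), HasDerivAt u (u' r) r)
    (hder2 : ∀ r ∈ Ioi (0 : ℝ), HasDerivAt u' (u'' r) r)
    (hODE : ∀ r ∈ Ioi (0 : ℝ), u'' r + u' r / r = Real.exp (u r / 2) - Real.exp (-(u r) / 2))
    {c : ℝ} (hlim0 : Tendsto (fun r => r * u' r) (𝓝[>] 0) (𝓝 c))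
    (hbot : Tendsto u (𝓝[>] 0) atBot) (htop : Tendsto u atTop (𝓝 0))
    {r : ℝ} (hr : r ∈ Ioi (0 : ℝ)) : r * u' r ≤ c := by
  have hd : ∀ s ∈ Ioi (0 : ℝ), HasDerivAt (fun r => r * u' r) _ s :=
    fun s hs => sinhGordon_hasDerivAt_mul_deriv hder2 hODE hs
  have hanti : AntitoneOn (fun r => r * u' r) (Ioi 0) := by
    refine antitoneOn_of_hasDerivWithinAt_nonpos (convex_Ioi 0)
      (fun s hs => (hd s hs).continuousAt.continuousWithinAt)
      (fun s hs => (hd s (interior_subset hs)).hasDerivWithinAt) fun s hs => ?_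
    have hs0 : s ∈ Ioi (0 : ℝ) := interior_subset hs
    have hu := sinhGordon_nonpos_s10 hder1 hder2 hODE hbot htop s hs0
    refine mul_nonpos_of_nonneg_of_nonpos (mem_Ioi.1 hs0).le (sub_nonpos.2 ?_)
    exact Real.exp_le_exp.2 (by linarith)
  refine ge_of_tendsto hlim0 ?_
  filter_upwards [Ioo_mem_nhdsGT hr] with s hs using hanti hs.1 hr hs.2.le

/-- The discriminant inequality for the embedding in the borderline case `L = 2`. It follows from
`F' = M ^ 2 * (r / 2) * (1 - r * u' / 4) * exp (u / 2)` for the difference `F` of the two sides. -/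
lemma sinhGordon_sq_le
    (hder1 : ∀ r ∈ Ioi (0 : ℝ), HasDerivAt u (u' r) r)
    (hder2 : ∀ r ∈ Ioi (0 : ℝ), HasDerivAt u' (u'' r) r)
    (hODE : ∀ r ∈ Ioi (0 : ℝ), u'' r + u' r / r = Real.exp (u r / 2) - Real.exp (-(u r) / 2))
    {c M : ℝ} (hc : c ≤ 4) (hcM : M ^ 2 * (1 - c / 4) ^ 2 = 1)
    (hlim0 : Tendsto (fun r => r * u' r) (𝓝[>] 0) (𝓝 c))
    (hbot : Tendsto u (𝓝[>] 0) atBot) (htop : Tendsto u atTop (𝓝 0))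
    {r : ℝ} (hr : r ∈ Ioi (0 : ℝ)) :
    M ^ 2 * (1 - r * u' r / 4) ^ 2 ≤ 1 + M ^ 2 * r ^ 2 * Real.exp (-(u r) / 2) / 4 := by
  let F : ℝ → ℝ := fun r =>
    1 + M ^ 2 * r ^ 2 * Real.exp (-(u r) / 2) / 4 - M ^ 2 * (1 - r * u' r / 4) ^ 2
  have hF : ∀ s ∈ Ioi (0 : ℝ),
      HasDerivAt F (M ^ 2 * (s / 2) * (1 - s * u' s / 4) * Real.exp (u s / 2)) s := by
    intro s hs
    have hp := sinhGordon_hasDerivAt_mul_deriv hder2 hODE hs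
    have he : HasDerivAt (fun r => Real.exp (-(u r) / 2)) _ s := ((hder1 s hs).neg.div_const 2).exp
    have hsq : HasDerivAt (fun r : ℝ => M ^ 2 * r ^ 2) _ s := (hasDerivAt_pow 2 s).const_mul (M ^ 2)
    have h := (((hsq.mul he).div_const 4).const_add 1).sub
      ((((hp.div_const 4).const_sub 1).pow 2).const_mul (M ^ 2))
    refine h.congr_deriv ?_
    simp only [Pi.neg_apply]
    push_cast
    ring
  have hmono : MonotoneOn F (Ioi 0) := by
    refine monotoneOn_of_hasDerivWithinAt_nonneg (convex_Ioi 0)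
      (fun s hs => (hF s hs).continuousAt.continuousWithinAt)
      (fun s hs => (hF s (interior_subset hs)).hasDerivWithinAt) fun s hs => ?_
    have hs0 : s ∈ Ioi (0 : ℝ) := interior_subset hs
    have hp := sinhGordon_mul_deriv_le hder1 hder2 hODE hlim0 hbot htop hs0
    have h1 : 0 ≤ 1 - s * u' s / 4 := by linarith
    have h2 : (0 : ℝ) < s := hs0
    positivity
  have hlim : Tendsto (fun s => 1 - M ^ 2 * (1 - s * u' s / 4) ^ 2) (𝓝[>] 0) (𝓝 0) := by
    have h := (((hlim0.div_const 4).const_sub 1).pow 2).const_mul (M ^ 2) |>.const_sub 1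
    rwa [hcM, sub_self] at h
  have hFr : 0 ≤ F r := by
    refine le_of_tendsto hlim ?_
    filter_upwards [Ioo_mem_nhdsGT hr] with s hs
    refine le_trans ?_ (hmono hs.1 hr hs.2.le)
    have : 0 ≤ M ^ 2 * s ^ 2 * Real.exp (-(u s) / 2) / 4 := by positivity
    simp only [F]
    linarith
  exact sub_nonneg.1 hFr

end SinhGordon


theorem sinhGordon_hyperbolic_embedding
    (N : ℕ) (hN : 0 < N) (u u' u'' : ℝ → ℝ)
    (hder1 : ∀ r ∈ Set.Ioi (0:ℝ), HasDerivAt u (u' r) r)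
    (hder2 : ∀ r ∈ Set.Ioi (0:ℝ), HasDerivAt u' (u'' r) r)
    (hcont : ContinuousOn u'' (Set.Ioi (0:ℝ)))
    (hne : ∃ r ∈ Set.Ioi (0:ℝ), u r ≠ 0)
    (hODE : ∀ r ∈ Set.Ioi (0:ℝ),
      u'' r + u' r / r = Real.exp (u r / 2) - Real.exp (-(u r) / 2))
    (hlim0 : Filter.Tendsto (fun r => r * u' r) (nhdsWithin 0 (Set.Ioi 0))
      (nhds (4 * (N:ℝ) / ((N:ℝ) + 2))))
    (hbot : Filter.Tendsto u (nhdsWithin 0 (Set.Ioi 0)) Filter.atBot)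
    (htop : Filter.Tendsto u Filter.atTop (nhds 0))
    (L : ℝ) (hL : 0 < L) (hL4 : L ^ 2 ≤ 4) :
    ∃ z ρ z' ρ' : ℝ → ℝ,
      (∀ r ∈ Set.Ioi (0:ℝ), HasDerivAt z (z' r) r) ∧
      (∀ r ∈ Set.Ioi (0:ℝ), HasDerivAt ρ (ρ' r) r) ∧
      ContinuousOn z' (Set.Ioi (0:ℝ)) ∧ ContinuousOn ρ' (Set.Ioi (0:ℝ)) ∧
      (∀ r ∈ Set.Ioi (0:ℝ), 0 < z r) ∧
      (∀ r ∈ Set.Ioi (0:ℝ),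
        L * ρ r / z r = (((N:ℝ) + 2) / 2) * r * Real.exp (-(u r) / 4)) ∧
      (∀ r ∈ Set.Ioi (0:ℝ),
        L ^ 2 * (z' r ^ 2 + ρ' r ^ 2) / z r ^ 2 = Real.exp (-(u r) / 2)) := by
  obtain ⟨M, hM⟩ : ∃ M : ℝ, M = ((N : ℝ) + 2) / 2 := ⟨_, rfl⟩
  have hN2 : (0 : ℝ) < (N : ℝ) + 2 := by positivity
  have hc : 4 * (N : ℝ) / ((N : ℝ) + 2) ≤ 4 := by
    rw [div_le_iff₀ hN2]
    linarith
  have hcM : M ^ 2 * (1 - 4 * (N : ℝ) / ((N : ℝ) + 2) / 4) ^ 2 = 1 := by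
    rw [hM]
    field_simp
    ring
  have huc : ContinuousOn u (Ioi 0) := fun r hr => (hder1 r hr).continuousAt.continuousWithinAt
  have hu'c : ContinuousOn u' (Ioi 0) := fun r hr => (hder2 r hr).continuousAt.continuousWithinAt
  have hg : ∀ r ∈ Ioi (0 : ℝ), HasDerivAt (fun r => M / L * (r * Real.exp (-(u r) / 4)))
      (M / L * ((1 - r * u' r / 4) * Real.exp (-(u r) / 4))) r := by
    intro r hr
    refine (((hasDerivAt_id r).mul ((hder1 r hr).neg.div_const 4).exp).const_mul
      (M / L)).congr_deriv ?_
    simp only [id, Pi.neg_apply]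
    ring
  have hsq : ∀ r, Real.exp (-(u r) / 4) ^ 2 = Real.exp (-(u r) / 2) := fun r => by
    rw [← Real.exp_nat_mul]
    congr 1
    push_cast
    ring
  obtain ⟨z, ρ, z', ρ', hz, hρ, hz', hρ', hpos, hquot, hlen⟩ :=
    exists_profile_of_sq_le (h := fun r => Real.exp (-(u r) / 2) / L ^ 2) hg
      (by fun_prop) (by fun_prop) fun r hr => by
        have h := sinhGordon_sq_le hder1 hder2 hODE hc hcM hlim0 hbot htop hr
        have hE := Real.exp_pos (-(u r) / 2)
        have hL' : M ^ 2 * r ^ 2 * Real.exp (-(u r) / 2) / 4 ≤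
            M ^ 2 * r ^ 2 * Real.exp (-(u r) / 2) / L ^ 2 := by gcongr
        calc (M / L * ((1 - r * u' r / 4) * Real.exp (-(u r) / 4))) ^ 2
            = Real.exp (-(u r) / 2) / L ^ 2 * (M ^ 2 * (1 - r * u' r / 4) ^ 2) := by
              rw [← hsq]
              ring
          _ ≤ Real.exp (-(u r) / 2) / L ^ 2 *
                (1 + M ^ 2 * r ^ 2 * Real.exp (-(u r) / 2) / L ^ 2) := by
              gcongr
              exact h.trans (by gcongr)
          _ = Real.exp (-(u r) / 2) / L ^ 2 *
                (1 + (M / L * (r * Real.exp (-(u r) / 4))) ^ 2) := by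
              rw [mul_pow, mul_pow, hsq]
              ring
  refine ⟨z, ρ, z', ρ', hz, hρ, hz', hρ', fun r _ => hpos r, fun r _ => ?_, fun r hr => ?_⟩
  · rw [mul_div_assoc, hquot, ← hM]
    field_simp
  · rw [mul_div_assoc, hlen r hr]
    field_simp
end

section
/- Let u be as in the context (a radial solution of the Tzitzeica equation describing an N-vortex). Then u'(r) > 0 and u(r) < 0 for all r ∈ (0, ∞). -/
open Set Filter Topology

/-- The Tzitzeica nonlinearity is bounded below by its linearisation times an exponential. -/
lemma mul_exp_le_tzitzeica (x : ℝ) :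
    x * Real.exp (-(2 * x) / 3) ≤ Real.exp (x / 3) - Real.exp (-(2 * x) / 3) := by
  have h : Real.exp (x / 3) = Real.exp x * Real.exp (-(2 * x) / 3) := by
    rw [← Real.exp_add]; congr 1; ring
  nlinarith [Real.add_one_le_exp x, Real.exp_pos (-(2 * x) / 3)]

/-- The radial Laplacian in divergence form: `(r u')' = r f(u)`. -/
lemma hasDerivAt_mul_of_radial {v w : ℝ → ℝ} {r g : ℝ} (hr : 0 < r)
    (hv : HasDerivAt v (w r) r) (h : w r + v r / r = g) :
    HasDerivAt (fun s => s * v s) (r * g) r := by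
  have h1 := (hasDerivAt_id' r).mul hv
  have h2 : 1 * v r + r * w r = r * g := by
    rw [← h]; field_simp; ring
  rwa [h2] at h1

/-- A solution of the radial equation `(r u')' = r f`, with `f > 0` wherever `u > 0`, that tends
to `-∞` at the origin and to `0` at infinity is nonpositive. -/
lemma nonpos_of_radial {u v f : ℝ → ℝ}
    (hu : ∀ r ∈ Ioi (0 : ℝ), HasDerivAt u (v r) r)
    (hv : ∀ r ∈ Ioi (0 : ℝ), HasDerivAt (fun s => s * v s) (r * f r) r)
    (hf : ∀ r ∈ Ioi (0 : ℝ), 0 < u r → 0 < f r)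
    (hbot : Tendsto u (𝓝[>] 0) atBot) (htop : Tendsto u atTop (𝓝 0)) :
    ∀ r ∈ Ioi (0 : ℝ), u r ≤ 0 := by
  intro r hr
  by_contra! hpos
  rw [mem_Ioi] at hr
  obtain ⟨δ, hδu, hδ0, hδr⟩ : ∃ δ, u δ < u r ∧ 0 < δ ∧ δ < r :=
    ((hbot.eventually_lt_atBot (u r)).and (Ioo_mem_nhdsGT hr)).exists
  obtain ⟨R, hRu, hrR⟩ : ∃ R, u R < u r ∧ r < R :=
    ((htop.eventually_lt_const hpos).and (eventually_gt_atTop r)).exists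
  have hcont : ContinuousOn u (Icc δ R) := fun x hx =>
    (hu x (hδ0.trans_le hx.1)).continuousAt.continuousWithinAt
  obtain ⟨c, hc, hmax⟩ := isCompact_Icc.exists_isMaxOn ⟨r, hδr.le, hrR.le⟩ hcont
  have hcr : u r ≤ u c := hmax ⟨hδr.le, hrR.le⟩
  have hδc : δ < c := lt_of_le_of_ne hc.1 (by rintro rfl; linarith)
  have hcR : c < R := lt_of_le_of_ne hc.2 (by rintro rfl; linarith)
  have hc0 : 0 < c := hδ0.trans hδc
  have hvc : v c = 0 :=
    (hmax.isLocalMax (Icc_mem_nhds hδc hcR)).hasDerivAt_eq_zero (hu c hc0)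
  obtain ⟨b, hcb, hb⟩ : ∃ b, c < b ∧ ∀ x ∈ Icc c b, 0 < u x := by
    have hev : ∀ᶠ x in 𝓝 c, 0 < u x :=
      (hu c hc0).continuousAt.eventually_const_lt (hpos.trans_le hcr)
    obtain ⟨ε, hε, hball⟩ := Metric.eventually_nhds_iff.1 hev
    refine ⟨c + ε / 2, by linarith, fun x hx => hball ?_⟩
    rw [Real.dist_eq, abs_lt]
    constructor <;> linarith [hx.1, hx.2]
  have hmono : StrictMonoOn (fun s => s * v s) (Icc c b) := by
    refine strictMonoOn_of_hasDerivWithinAt_pos (f' := fun x => x * f x) (convex_Icc c b)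
      (fun x hx => (hv x (hc0.trans_le hx.1)).continuousAt.continuousWithinAt) ?_ ?_
    · intro x hx
      rw [interior_Icc] at hx
      exact (hv x (hc0.trans hx.1)).hasDerivWithinAt
    · intro x hx
      rw [interior_Icc] at hx
      exact mul_pos (hc0.trans hx.1) (hf x (hc0.trans hx.1) (hb x (Ioo_subset_Icc_self hx)))
  have hmono' : StrictMonoOn u (Icc c b) := by
    refine strictMonoOn_of_hasDerivWithinAt_pos (f' := v) (convex_Icc c b)
      (fun x hx => (hu x (hc0.trans_le hx.1)).continuousAt.continuousWithinAt) ?_ ?_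
    · intro x hx
      rw [interior_Icc] at hx
      exact (hu x (hc0.trans hx.1)).hasDerivWithinAt
    · intro x hx
      rw [interior_Icc] at hx
      have := hmono ⟨le_rfl, hcb.le⟩ (Ioo_subset_Icc_self hx) hx.1
      simp only [hvc, mul_zero] at this
      exact pos_of_mul_pos_right this (hc0.trans hx.1).le
  have hm : c < min b R := lt_min hcb hcR
  have h1 := hmono' ⟨le_rfl, hcb.le⟩ ⟨hm.le, min_le_left _ _⟩ hm
  have h2 : u (min b R) ≤ u c := hmax ⟨hδc.le.trans hm.le, min_le_right _ _⟩
  linarith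

/-- Backward Grönwall argument: a function with `F' ≥ -C F` on `[a, b]` and
`F b = 0` has `F a ≤ 0`. -/
lemma nonpos_left_of_deriv_ge {F F' : ℝ → ℝ} {a b C : ℝ} (hab : a ≤ b)
    (hF : ∀ x ∈ Icc a b, HasDerivAt F (F' x) x)
    (hF' : ∀ x ∈ Icc a b, -(C * F x) ≤ F' x) (hb : F b = 0) : F a ≤ 0 := by
  have hd : ∀ x ∈ Icc a b, HasDerivAt (fun s => F s * Real.exp (C * s))
      (F' x * Real.exp (C * x) + F x * (Real.exp (C * x) * (C * 1))) x := fun x hx =>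
    (hF x hx).mul (((hasDerivAt_id' x).const_mul C).exp)
  have hmono : MonotoneOn (fun s => F s * Real.exp (C * s)) (Icc a b) := by
    refine monotoneOn_of_hasDerivWithinAt_nonneg (convex_Icc a b)
      (fun x hx => (hd x hx).continuousAt.continuousWithinAt)
      (fun x hx => (hd x (interior_subset hx)).hasDerivWithinAt) fun x hx => ?_
    nlinarith [hF' x (interior_subset hx), Real.exp_pos (C * x)]
  have h := hmono ⟨le_rfl, hab⟩ ⟨hab, le_rfl⟩ hab
  simp only [hb, zero_mul] at h
  exact nonpos_of_mul_nonpos_left h (Real.exp_pos _)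


theorem tzitzeica_vortex_monotone_neg
    (N : ℕ) (hN : 0 < N) (u u' u'' : ℝ → ℝ)
    (hder1 : ∀ r ∈ Set.Ioi (0:ℝ), HasDerivAt u (u' r) r)
    (hder2 : ∀ r ∈ Set.Ioi (0:ℝ), HasDerivAt u' (u'' r) r)
    (hcont : ContinuousOn u'' (Set.Ioi (0:ℝ)))
    (hne : ∃ r ∈ Set.Ioi (0:ℝ), u r ≠ 0)
    (hODE : ∀ r ∈ Set.Ioi (0:ℝ),
      u'' r + u' r / r = Real.exp (u r / 3) - Real.exp (-(2 * u r) / 3))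
    (hlim0 : Filter.Tendsto (fun r => r * u' r) (nhdsWithin 0 (Set.Ioi 0))
      (nhds (6 * (N:ℝ) / (2 * (N:ℝ) + 3))))
    (hbot : Filter.Tendsto u (nhdsWithin 0 (Set.Ioi 0)) Filter.atBot)
    (htop : Filter.Tendsto u Filter.atTop (nhds 0)) :
    ∀ r ∈ Set.Ioi (0:ℝ), 0 < u' r ∧ u r < 0 := by
  set f : ℝ → ℝ := fun r => Real.exp (u r / 3) - Real.exp (-(2 * u r) / 3)
  have hw : ∀ r ∈ Ioi (0 : ℝ), HasDerivAt (fun s => s * u' s) (r * f r) r := fun r hr =>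
    hasDerivAt_mul_of_radial hr (hder2 r hr) (hODE r hr)
  have hnonpos : ∀ r ∈ Ioi (0 : ℝ), u r ≤ 0 :=
    nonpos_of_radial hder1 hw
      (fun r _ hr => sub_pos.2 (Real.exp_lt_exp.2 (by linarith))) hbot htop
  have hf_nonpos : ∀ r ∈ Ioi (0 : ℝ), f r ≤ 0 := fun r hr =>
    sub_nonpos.2 (Real.exp_le_exp.2 (by linarith [hnonpos r hr]))
  have hanti : AntitoneOn (fun s => s * u' s) (Ioi 0) := by
    refine antitoneOn_of_hasDerivWithinAt_nonpos (f' := fun r => r * f r) (convex_Ioi 0)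
      (fun x hx => (hw x hx).continuousAt.continuousWithinAt)
      (fun x hx => (hw x (interior_subset hx)).hasDerivWithinAt) fun x hx => ?_
    exact mul_nonpos_of_nonneg_of_nonpos (le_of_lt (interior_subset hx))
      (hf_nonpos x (interior_subset hx))
  have hpos : ∀ r ∈ Ioi (0 : ℝ), 0 < u' r := by
    intro a ha
    by_contra! hneg
    have ha0 : 0 < a := ha
    have hu_anti : AntitoneOn u (Ici a) := by
      refine antitoneOn_of_hasDerivWithinAt_nonpos (f' := u') (convex_Ici a)
        (fun x hx => (hder1 x (ha0.trans_le hx)).continuousAt.continuousWithinAt)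
        (fun x hx => (hder1 x (ha0.trans_le (interior_subset hx))).hasDerivWithinAt)
        fun x hx => ?_
      have hax : a ≤ x := interior_subset hx
      have h : x * u' x ≤ a * u' a := hanti ha (ha0.trans_le hax) hax
      have h' : x * u' x ≤ 0 := h.trans (mul_nonpos_of_nonneg_of_nonpos ha0.le hneg)
      exact nonpos_of_mul_nonpos_right h' (ha0.trans_le hax)
    have hua : u a = 0 := by
      refine le_antisymm (hnonpos a ha) (le_of_tendsto htop ?_)
      filter_upwards [eventually_ge_atTop a] with x hx
      exact hu_anti self_mem_Ici hx hx
    have hu'a : u' a = 0 := by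
      refine IsLocalMax.hasDerivAt_eq_zero ?_ (hder1 a ha)
      filter_upwards [Ioi_mem_nhds ha0] with x hx
      rw [hua]
      exact hnonpos x hx
    obtain ⟨ε, hεu, hε0, hεa⟩ : ∃ ε, u ε < 0 ∧ 0 < ε ∧ ε < a :=
      ((hbot.eventually_lt_atBot 0).and (Ioo_mem_nhdsGT ha0)).exists
    have hw_nonneg : ∀ x ∈ Icc ε a, 0 ≤ x * u' x := fun x hx => by
      have h : a * u' a ≤ x * u' x := hanti (hε0.trans_le hx.1) ha hx.2
      rwa [hu'a, mul_zero] at h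
    have hu_mono : MonotoneOn u (Icc ε a) := by
      refine monotoneOn_of_hasDerivWithinAt_nonneg (f' := u') (convex_Icc ε a)
        (fun x hx => (hder1 x (hε0.trans_le hx.1)).continuousAt.continuousWithinAt)
        (fun x hx => (hder1 x (hε0.trans_le (interior_subset hx).1)).hasDerivWithinAt)
        fun x hx => ?_
      have hx' := interior_subset hx
      exact nonneg_of_mul_nonneg_right (hw_nonneg x hx') (hε0.trans_le hx'.1)
    set K := Real.exp (-(2 * u ε) / 3)
    have key : -u ε + ε * u' ε ≤ 0 := by
      refine nonpos_left_of_deriv_ge (F := fun x => -u x + x * u' x)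
        (F' := fun x => -u' x + x * f x) (C := 1 / ε + a * K) hεa.le
        (fun x hx => (hder1 x (hε0.trans_le hx.1)).neg.add (hw x (hε0.trans_le hx.1)))
        (fun x hx => ?_) (by simp [hua, hu'a])
      have hx0 : 0 < x := hε0.trans_le hx.1
      have hux : u x ≤ 0 := hnonpos x hx0
      have hwx := hw_nonneg x hx
      have h1 : u' x ≤ 1 / ε * (x * u' x) := by
        rw [one_div, inv_mul_eq_div, le_div_iff₀ hε0]
        nlinarith [hx.1, nonneg_of_mul_nonneg_right hwx hx0]
      have h2 : u x * K ≤ f x := by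
        refine le_trans ?_ (mul_exp_le_tzitzeica (u x))
        refine mul_le_mul_of_nonpos_left (Real.exp_le_exp.2 ?_) hux
        linarith [hu_mono ⟨le_rfl, hεa.le⟩ hx hx.1]
      have hK0 : 0 < K := Real.exp_pos _
      have h3 : a * (u x * K) ≤ x * f x := by
        have := mul_le_mul_of_nonneg_left h2 hx0.le
        have := mul_le_mul_of_nonpos_right hx.2 (mul_nonpos_of_nonpos_of_nonneg hux hK0.le)
        linarith
      have h4 : 0 ≤ 1 / ε * (-u x) := mul_nonneg (by positivity) (by linarith)
      have h5 : 0 ≤ a * K * (x * u' x) := mul_nonneg (by positivity) hwx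
      linarith
    linarith [hw_nonneg ε ⟨le_rfl, hεa.le⟩]
  have hmono : StrictMonoOn u (Ioi 0) :=
    strictMonoOn_of_hasDerivWithinAt_pos (f' := u') (convex_Ioi 0)
      (fun x hx => (hder1 x hx).continuousAt.continuousWithinAt)
      (fun x hx => (hder1 x (interior_subset hx)).hasDerivWithinAt)
      fun x hx => hpos x (interior_subset hx)
  intro r hr
  have hr1 : r + 1 ∈ Ioi (0 : ℝ) := add_pos (mem_Ioi.1 hr) one_pos
  exact ⟨hpos r hr, (hmono hr hr1 (lt_add_one r)).trans_le (hnonpos _ hr1)⟩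
end

section
/- Let u be as in the context (a radial solution of the Tzitzeica equation describing an N-vortex). Then for every r > 0 the function r ↦ r·u'(r) satisfies the identity (r·u'(r))' = r(e^{u(r)/3} − e^{−2u(r)/3}), it is strictly decreasing on (0,∞), and consequently 0 < r·u'(r) < 6N/(2N+3) for all r ∈ (0, ∞). -/
open Set Filter Topology

section RadialDerivative

variable {u u' : ℝ → ℝ} {a b : ℝ}

lemma tzitzeica_force_neg {x : ℝ} (hx : x < 0) :
    Real.exp (x / 3) - Real.exp (-(2 * x) / 3) < 0 :=
  sub_neg.2 (Real.exp_lt_exp.2 (by linarith))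

lemma tzitzeica_force_pos {x : ℝ} (hx : 0 < x) :
    0 < Real.exp (x / 3) - Real.exp (-(2 * x) / 3) :=
  sub_pos.2 (Real.exp_lt_exp.2 (by linarith))

/-- The nonlinearity is Lipschitz at `0` on `[-M, 0]`. -/
lemma tzitzeica_force_lower_bound {x M : ℝ} (hx : x ≤ 0) (hM : -M ≤ x) :
    Real.exp (2 * M / 3) * x ≤ Real.exp (x / 3) - Real.exp (-(2 * x) / 3) := by
  have h : Real.exp (x / 3) = Real.exp (-(2 * x) / 3) * Real.exp x := by
    rw [← Real.exp_add]; ring_nf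
  have h₁ : Real.exp (-(2 * x) / 3) ≤ Real.exp (2 * M / 3) :=
    Real.exp_le_exp.2 (by linarith)
  have h₂ := mul_le_mul_of_nonneg_left (Real.add_one_le_exp x) (Real.exp_pos (-(2 * x) / 3)).le
  have h₃ := mul_le_mul_of_nonpos_right h₁ hx
  rw [h]
  linarith

lemma strictMonoOn_Icc_of_mul_deriv_pos (ha : 0 < a)
    (hu : ∀ r ∈ Ioi (0:ℝ), HasDerivAt u (u' r) r) (hpos : ∀ r ∈ Ioo a b, 0 < r * u' r) :
    StrictMonoOn u (Icc a b) := by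
  refine strictMonoOn_of_deriv_pos (convex_Icc a b)
    (fun r hr => (hu r (ha.trans_le hr.1)).continuousAt.continuousWithinAt) fun r hr => ?_
  rw [interior_Icc] at hr
  rw [(hu r (ha.trans hr.1)).deriv]
  exact pos_of_mul_pos_right (hpos r hr) (ha.trans hr.1).le

lemma monotoneOn_Icc_of_mul_deriv_nonneg (ha : 0 < a)
    (hu : ∀ r ∈ Ioi (0:ℝ), HasDerivAt u (u' r) r) (hpos : ∀ r ∈ Ioo a b, 0 ≤ r * u' r) :
    MonotoneOn u (Icc a b) := by
  refine monotoneOn_of_deriv_nonneg (convex_Icc a b)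
    (fun r hr => (hu r (ha.trans_le hr.1)).continuousAt.continuousWithinAt)
    (fun r hr => ?_) fun r hr => ?_ <;> rw [interior_Icc] at hr
  · exact (hu r (ha.trans hr.1)).differentiableAt.differentiableWithinAt
  · rw [(hu r (ha.trans hr.1)).deriv]
    exact nonneg_of_mul_nonneg_right (hpos r hr) (ha.trans hr.1)

lemma antitoneOn_Ici_of_mul_deriv_nonpos (ha : 0 < a)
    (hu : ∀ r ∈ Ioi (0:ℝ), HasDerivAt u (u' r) r) (hneg : ∀ r ∈ Ioi a, r * u' r ≤ 0) :
    AntitoneOn u (Ici a) := by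
  refine antitoneOn_of_deriv_nonpos (convex_Ici a)
    (fun r hr => (hu r (ha.trans_le hr)).continuousAt.continuousWithinAt)
    (fun r hr => ?_) fun r hr => ?_ <;> rw [interior_Ici] at hr
  · exact (hu r (ha.trans hr)).differentiableAt.differentiableWithinAt
  · rw [(hu r (ha.trans hr)).deriv]
    exact nonpos_of_mul_nonpos_right (hneg r hr) (ha.trans hr)

end RadialDerivative

/-- Maximum principle: a solution that is `-∞` at the origin and `0` at infinity is nonpositive. -/
lemma tzitzeica_nonpos {u u' : ℝ → ℝ}
    (hu : ∀ r ∈ Ioi (0:ℝ), HasDerivAt u (u' r) r)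
    (hv : ∀ r ∈ Ioi (0:ℝ), HasDerivAt (fun t => t * u' t)
      (r * (Real.exp (u r / 3) - Real.exp (-(2 * u r) / 3))) r)
    (hbot : Tendsto u (𝓝[>] 0) atBot) (htop : Tendsto u atTop (𝓝 0)) :
    ∀ r ∈ Ioi (0:ℝ), u r ≤ 0 := by
  intro a (ha : 0 < a)
  by_contra! hua
  obtain ⟨δ, hδa, hδ0, hδ'⟩ : ∃ δ, δ < a ∧ 0 < δ ∧ ∀ r ∈ Ioc 0 δ, u r < 0 := by
    obtain ⟨ε, hε, h⟩ := mem_nhdsGT_iff_exists_Ioc_subset.1 (hbot.eventually_lt_atBot 0)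
    have hε' : 0 < min ε (a / 2) := lt_min hε (by linarith)
    exact ⟨min ε (a / 2), (min_le_right _ _).trans_lt (by linarith), hε',
      fun r hr => h ⟨hr.1, hr.2.trans (min_le_left _ _)⟩⟩
  obtain ⟨R, hR⟩ := eventually_atTop.1 (htop.eventually_lt_const hua)
  have haR : a < R := by
    by_contra! h
    exact lt_irrefl _ (hR a h)
  obtain ⟨b, hb, hmax⟩ := isCompact_Icc.exists_isMaxOn ⟨a, hδa.le, haR.le⟩
    (fun r hr => (hu r (hδ0.trans_le hr.1)).continuousAt.continuousWithinAt :
      ContinuousOn u (Icc δ R))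
  have hab : u a ≤ u b := hmax ⟨hδa.le, haR.le⟩
  have hb0 : 0 < b := hδ0.trans_le hb.1
  have hglobal : ∀ r ∈ Ioi (0:ℝ), u r ≤ u b := by
    intro r hr
    rcases le_total r δ with h | h
    · linarith [hδ' r ⟨hr, h⟩]
    rcases le_total r R with h' | h'
    · exact hmax ⟨h, h'⟩
    · linarith [hR r h']
  have hu'b : u' b = 0 :=
    IsLocalMax.hasDerivAt_eq_zero (eventually_of_mem (Ioi_mem_nhds hb0) hglobal) (hu b hb0)
  obtain ⟨c, hbc, hc⟩ := mem_nhdsGE_iff_exists_Icc_subset.1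
    (mem_nhdsWithin_of_mem_nhds
      ((hu b hb0).continuousAt.eventually_const_lt (hua.trans_le hab)))
  have hmono : StrictMonoOn (fun t => t * u' t) (Icc b c) := by
    refine strictMonoOn_of_deriv_pos (convex_Icc b c)
      (fun r hr => (hv r (hb0.trans_le hr.1)).continuousAt.continuousWithinAt) fun r hr => ?_
    rw [interior_Icc] at hr
    rw [(hv r (hb0.trans hr.1)).deriv]
    exact mul_pos (hb0.trans hr.1) (tzitzeica_force_pos (hc (Ioo_subset_Icc_self hr)))
  have hbc' : b ≤ c := le_of_lt hbc
  have hlt : u b < u c := by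
    refine strictMonoOn_Icc_of_mul_deriv_pos hb0 hu (fun r hr => ?_)
      (left_mem_Icc.2 hbc') (right_mem_Icc.2 hbc') hbc
    simpa [hu'b] using hmono (left_mem_Icc.2 hbc') (Ioo_subset_Icc_self hr) hr.1
  exact absurd (hglobal c (hb0.trans hbc)) (not_le.2 hlt)

/-- Strong maximum principle: such a solution does not touch `0`. -/
lemma tzitzeica_neg {u u' : ℝ → ℝ}
    (hu : ∀ r ∈ Ioi (0:ℝ), HasDerivAt u (u' r) r)
    (hv : ∀ r ∈ Ioi (0:ℝ), HasDerivAt (fun t => t * u' t)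
      (r * (Real.exp (u r / 3) - Real.exp (-(2 * u r) / 3))) r)
    (hbot : Tendsto u (𝓝[>] 0) atBot) (htop : Tendsto u atTop (𝓝 0)) :
    ∀ r ∈ Ioi (0:ℝ), u r < 0 := by
  have hnonpos := tzitzeica_nonpos hu hv hbot htop
  intro a (ha : 0 < a)
  refine (hnonpos a ha).lt_of_ne fun hua => ?_
  have hu'a : u' a = 0 := by
    refine IsLocalMax.hasDerivAt_eq_zero (eventually_of_mem (Ioi_mem_nhds ha) ?_) (hu a ha)
    simpa [hua] using hnonpos
  have hanti : AntitoneOn (fun t => t * u' t) (Ioi 0) := by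
    refine antitoneOn_of_deriv_nonpos (convex_Ioi 0)
      (fun r hr => (hv r hr).continuousAt.continuousWithinAt)
      (fun r hr => ?_) fun r hr => ?_ <;> rw [interior_Ioi] at hr
    · exact (hv r hr).differentiableAt.differentiableWithinAt
    · rw [(hv r hr).deriv]
      exact mul_nonpos_of_nonneg_of_nonpos (le_of_lt hr)
        (sub_nonpos.2 (Real.exp_le_exp.2 (by linarith [hnonpos r hr])))
  have hvnonneg : ∀ r ∈ Ioc 0 a, 0 ≤ r * u' r := fun r hr => by
    simpa [hu'a] using hanti hr.1 ha hr.2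
  obtain ⟨c, huc, hc0, hca⟩ : ∃ c, u c < 0 ∧ 0 < c ∧ c < a :=
    ((hbot.eventually_lt_atBot 0).and (Ioo_mem_nhdsGT ha)).exists
  have hmono := monotoneOn_Icc_of_mul_deriv_nonneg hc0 hu
    fun r hr => hvnonneg r ⟨hc0.trans hr.1, hr.2.le⟩
  set K := Real.exp (2 * -u c / 3)
  set C := a * K + 1 / c
  have hderiv : ∀ r ∈ Ioi (0:ℝ), HasDerivAt (fun t => (t * u' t - u t) * Real.exp (C * t))
      ((r * (Real.exp (u r / 3) - Real.exp (-(2 * u r) / 3)) - u' r) * Real.exp (C * r)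
        + (r * u' r - u r) * (Real.exp (C * r) * C)) r := fun r hr => by
    have h := ((hasDerivAt_id r).const_mul C).exp
    simp only [id, mul_one] at h
    exact ((hv r hr).sub (hu r hr)).mul h
  have hgrow : MonotoneOn (fun t => (t * u' t - u t) * Real.exp (C * t)) (Icc c a) := by
    refine monotoneOn_of_deriv_nonneg (convex_Icc c a)
      (fun r hr => (hderiv r (hc0.trans_le hr.1)).continuousAt.continuousWithinAt)
      (fun r hr => ?_) fun r hr => ?_ <;> rw [interior_Icc] at hr
    · exact (hderiv r (hc0.trans hr.1)).differentiableAt.differentiableWithinAt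
    have hr0 : 0 < r := hc0.trans hr.1
    have hur := hnonpos r hr0
    have hvr := hvnonneg r ⟨hr0, hr.2.le⟩
    rw [(hderiv r hr0).deriv]
    have hforce : K * u r ≤ Real.exp (u r / 3) - Real.exp (-(2 * u r) / 3) :=
      tzitzeica_force_lower_bound hur
        (by simpa using hmono (left_mem_Icc.2 hca.le) (Ioo_subset_Icc_self hr) hr.1.le)
    have hK : 0 < K := Real.exp_pos _
    have h₁ : a * (K * u r) ≤ r * (Real.exp (u r / 3) - Real.exp (-(2 * u r) / 3)) :=
      (mul_le_mul_of_nonpos_right hr.2.le (mul_nonpos_of_nonneg_of_nonpos hK.le hur)).trans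
        (mul_le_mul_of_nonneg_left hforce hr0.le)
    have h₂ : u' r ≤ 1 / c * (r * u' r) := by
      have hu'r : 0 ≤ u' r := nonneg_of_mul_nonneg_right hvr hr0
      rw [one_div, inv_mul_eq_div, le_div_iff₀ hc0, mul_comm]
      exact mul_le_mul_of_nonneg_right hr.1.le hu'r
    have h₃ : 0 ≤ a * K * (r * u' r) := by positivity
    have h₄ : 0 ≤ 1 / c * (-u r) := mul_nonneg (by positivity) (by linarith)
    have h₅ : 0 ≤ r * (Real.exp (u r / 3) - Real.exp (-(2 * u r) / 3)) - u' r
        + (r * u' r - u r) * C := by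
      simp only [C]
      linarith
    have := mul_nonneg h₅ (Real.exp_pos (C * r)).le
    linarith
  have hle : (c * u' c - u c) * Real.exp (C * c) ≤ 0 := by
    simpa [hu'a, hua] using hgrow (left_mem_Icc.2 hca.le) (right_mem_Icc.2 hca.le) hca.le
  have hpos : 0 < (c * u' c - u c) * Real.exp (C * c) :=
    mul_pos (by linarith [hvnonneg c ⟨hc0, hca.le⟩]) (Real.exp_pos _)
  linarith


theorem tzitzeica_ru'_strictAnti
    (N : ℕ) (hN : 0 < N) (u u' u'' : ℝ → ℝ)
    (hder1 : ∀ r ∈ Set.Ioi (0:ℝ), HasDerivAt u (u' r) r)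
    (hder2 : ∀ r ∈ Set.Ioi (0:ℝ), HasDerivAt u' (u'' r) r)
    (hcont : ContinuousOn u'' (Set.Ioi (0:ℝ)))
    (hne : ∃ r ∈ Set.Ioi (0:ℝ), u r ≠ 0)
    (hODE : ∀ r ∈ Set.Ioi (0:ℝ),
      u'' r + u' r / r = Real.exp (u r / 3) - Real.exp (-(2 * u r) / 3))
    (hlim0 : Filter.Tendsto (fun r => r * u' r) (nhdsWithin 0 (Set.Ioi 0))
      (nhds (6 * (N:ℝ) / (2 * (N:ℝ) + 3))))
    (hbot : Filter.Tendsto u (nhdsWithin 0 (Set.Ioi 0)) Filter.atBot)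
    (htop : Filter.Tendsto u Filter.atTop (nhds 0)) :
    (∀ r ∈ Set.Ioi (0:ℝ), HasDerivAt (fun t => t * u' t)
      (r * (Real.exp (u r / 3) - Real.exp (-(2 * u r) / 3))) r) ∧
    StrictAntiOn (fun r => r * u' r) (Set.Ioi (0:ℝ)) ∧
    ∀ r ∈ Set.Ioi (0:ℝ), 0 < r * u' r ∧ r * u' r < 6 * (N:ℝ) / (2 * (N:ℝ) + 3) := by
  have hv : ∀ r ∈ Set.Ioi (0:ℝ), HasDerivAt (fun t => t * u' t)
      (r * (Real.exp (u r / 3) - Real.exp (-(2 * u r) / 3))) r := by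
    intro r hr
    refine ((hasDerivAt_id r).mul (hder2 r hr)).congr_deriv ?_
    have hr0 : r ≠ 0 := ne_of_gt hr
    rw [← hODE r hr]
    simp only [id]
    field_simp
    ring
  have hneg := tzitzeica_neg hder1 hv hbot htop
  have hanti : StrictAntiOn (fun r => r * u' r) (Set.Ioi (0:ℝ)) := by
    refine strictAntiOn_of_deriv_neg (convex_Ioi 0)
      (fun r hr => (hv r hr).continuousAt.continuousWithinAt) fun r hr => ?_
    rw [interior_Ioi] at hr
    rw [(hv r hr).deriv]
    exact mul_neg_of_pos_of_neg hr (tzitzeica_force_neg (hneg r hr))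
  refine ⟨hv, hanti, fun r (hr : 0 < r) => ⟨?_, ?_⟩⟩
  · by_contra! h
    have hu := antitoneOn_Ici_of_mul_deriv_nonpos hr hder1
      fun s hs => (hanti hr (hr.trans hs) hs).le.trans h
    have hge : 0 ≤ u r := le_of_tendsto htop
      ((eventually_ge_atTop r).mono fun s hs => hu self_mem_Ici hs hs)
    exact absurd (hneg r hr) (not_lt.2 hge)
  · have hr2 : 0 < r / 2 := half_pos hr
    refine (hanti hr2 hr (half_lt_self hr)).trans_le (ge_of_tendsto hlim0 ?_)
    filter_upwards [Ioo_mem_nhdsGT hr2] with s hs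
    exact (hanti hs.1 hr2 hs.2).le
end

section
/- Let u be as in the context (a radial solution of the Tzitzeica equation describing an N-vortex), let L > 0, set M = (2N+3)/3 and define P(r) = r²e^{−2u(r)/3} − L²(1 − 1/M − r·u'(r)/3)(1 + 1/M − r·u'(r)/3). Then P is differentiable on (0,∞) and P'(r) = 2r·e^{−2u(r)/3}·(1 − r·u'(r)/3)·(1 + (L²/3)(e^{u(r)} − 1)) for all r ∈ (0, ∞). -/
theorem tzitzeica_P_derivative
    (N : ℕ) (hN : 0 < N) (u u' u'' : ℝ → ℝ)
    (hder1 : ∀ r ∈ Set.Ioi (0:ℝ), HasDerivAt u (u' r) r)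
    (hder2 : ∀ r ∈ Set.Ioi (0:ℝ), HasDerivAt u' (u'' r) r)
    (hcont : ContinuousOn u'' (Set.Ioi (0:ℝ)))
    (hne : ∃ r ∈ Set.Ioi (0:ℝ), u r ≠ 0)
    (hODE : ∀ r ∈ Set.Ioi (0:ℝ),
      u'' r + u' r / r = Real.exp (u r / 3) - Real.exp (-(2 * u r) / 3))
    (hlim0 : Filter.Tendsto (fun r => r * u' r) (nhdsWithin 0 (Set.Ioi 0))
      (nhds (6 * (N:ℝ) / (2 * (N:ℝ) + 3))))
    (hbot : Filter.Tendsto u (nhdsWithin 0 (Set.Ioi 0)) Filter.atBot)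
    (htop : Filter.Tendsto u Filter.atTop (nhds 0))
    (L : ℝ) (hL : 0 < L) (M : ℝ) (hM : M = (2 * (N:ℝ) + 3) / 3) (P : ℝ → ℝ)
    (hP : ∀ r, P r = r ^ 2 * Real.exp (-(2 * u r) / 3) -
      L ^ 2 * (1 - 1 / M - r * u' r / 3) * (1 + 1 / M - r * u' r / 3)) :
    ∀ r ∈ Set.Ioi (0:ℝ), HasDerivAt P
      (2 * r * Real.exp (-(2 * u r) / 3) * (1 - r * u' r / 3) *
        (1 + (L ^ 2 / 3) * (Real.exp (u r) - 1))) r := by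
  intro r hr
  have hr0 : r ≠ 0 := (Set.mem_Ioi.mp hr).ne'
  have hru : HasDerivAt (fun x => x * u' x / 3) ((1 * u' r + r * u'' r) / 3) r :=
    ((hasDerivAt_id' r).mul (hder2 r hr)).div_const 3
  have hexp : HasDerivAt (fun x => Real.exp (-(2 * u x) / 3))
      (Real.exp (-(2 * u r) / 3) * (-(2 * u' r) / 3)) r :=
    (((hder1 r hr).const_mul 2).neg.div_const 3).exp
  have hPr := ((hasDerivAt_pow 2 r).mul hexp).sub
    (((hru.const_sub (1 - 1 / M)).const_mul (L ^ 2)).mul (hru.const_sub (1 + 1 / M)))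
  have hode : u' r + r * u'' r =
      r * (Real.exp (u r / 3) - Real.exp (-(2 * u r) / 3)) := by
    rw [← hODE r hr]
    field_simp
    ring
  have hexp_add : Real.exp (u r / 3) = Real.exp (-(2 * u r) / 3) * Real.exp (u r) := by
    rw [← Real.exp_add]
    ring_nf
  rw [hexp_add] at hode
  rw [show P = _ from funext hP]
  refine hPr.congr_deriv ?_
  push_cast
  linear_combination (2 / 3 * L ^ 2 * (1 - r * u' r / 3)) * hode
end

section
/- Let u be as in the context (a radial solution of the Tzitzeica equation describing an N-vortex), and assume additionally that lim_{r→∞} r·u'(r) = 0. Then the improper integral ∫₀^∞ (e^{u(r)/3} − e^{−2u(r)/3})·r dr converges and equals −6N/(2N+3). (Equivalently, the total Gaussian curvature of the regular Tzitzeica N-vortex surface Σ_N satisfies (1/2π)∫_{Σ_N} K vol = −2N/3, in agreement with the Gauss–Bonnet theorem with conical singularities.) -/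
open Filter Set Topology in
/-- A continuous function on `(0, ∞)` whose limits at both ends lie below one of its values
attains its maximum. -/
theorem exists_isMaxOn_Ioi_of_eventually_le {u : ℝ → ℝ} (hu : ContinuousOn u (Ioi 0))
    {r : ℝ} (hr : 0 < r) (hzero : ∀ᶠ x in 𝓝[>] (0 : ℝ), u x ≤ u r)
    (htop : ∀ᶠ x in atTop, u x ≤ u r) : ∃ x ∈ Ioi (0 : ℝ), IsMaxOn u (Ioi 0) x := by
  obtain ⟨a, ha, hau⟩ := mem_nhdsGT_iff_exists_Ioo_subset.1 hzero
  obtain ⟨b, hb⟩ := eventually_atTop.1 htop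
  have hm : 0 < min (a / 2) r := lt_min (half_pos ha) hr
  have hsub : Icc (min (a / 2) r) (max b r) ⊆ Ioi 0 := fun x hx => hm.trans_le hx.1
  have hrI : r ∈ Icc (min (a / 2) r) (max b r) := ⟨min_le_right _ _, le_max_right _ _⟩
  obtain ⟨x, hx, hmax⟩ := isCompact_Icc.exists_isMaxOn ⟨r, hrI⟩ (hu.mono hsub)
  refine ⟨x, hsub hx, fun y hy => ?_⟩
  have hrx : u r ≤ u x := hmax hrI
  rcases lt_or_ge y (min (a / 2) r) with h | h
  · have ha' : a / 2 < a := half_lt_self ha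
    exact (hau ⟨hy, (h.trans_le (min_le_left _ _)).trans ha'⟩).trans hrx
  · rcases le_or_gt y (max b r) with h' | h'
    · exact hmax ⟨h, h'⟩
    · exact (hb y ((le_max_left _ _).trans h'.le)).trans hrx

open Filter Topology in
/-- At a local maximum the second derivative is nonpositive. -/
theorem IsLocalMax.second_deriv_nonpos {u u' : ℝ → ℝ} {r c : ℝ} (hmax : IsLocalMax u r)
    (hu : ∀ᶠ x in 𝓝 r, HasDerivAt u (u' x) x) (hu' : HasDerivAt u' c r) : c ≤ 0 := by
  by_contra! hc
  have hderiv : deriv u =ᶠ[𝓝 r] u' := hu.mono fun x hx => hx.deriv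
  have hsecond : deriv (deriv u) r = c := (hu'.congr_of_eventuallyEq hderiv).deriv
  have hmin : IsLocalMin u r :=
    isLocalMin_of_deriv_deriv_pos (hsecond ▸ hc) hmax.deriv_eq_zero
      hu.self_of_nhds.continuousAt
  have hconst : u =ᶠ[𝓝 r] fun _ => u r :=
    hmax.and hmin |>.mono fun x hx => le_antisymm hx.1 hx.2
  have hzero : deriv (deriv u) r = 0 := by
    rw [hconst.deriv.deriv_eq]
    simp
  exact hc.ne (hzero.symm.trans hsecond)

open Filter Set Topology in
/-- Maximum principle: a solution of the radial Tzitzeica equation that is eventually nonpositive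
at the origin and vanishes at infinity is nonpositive. -/
theorem tzitzeica_nonpos_s17 {u u' u'' : ℝ → ℝ}
    (hu : ∀ r ∈ Ioi (0 : ℝ), HasDerivAt u (u' r) r)
    (hu' : ∀ r ∈ Ioi (0 : ℝ), HasDerivAt u' (u'' r) r)
    (hODE : ∀ r ∈ Ioi (0 : ℝ),
      u'' r + u' r / r = Real.exp (u r / 3) - Real.exp (-(2 * u r) / 3))
    (hzero : ∀ᶠ r in 𝓝[>] (0 : ℝ), u r ≤ 0) (htop : Tendsto u atTop (𝓝 0))
    {r : ℝ} (hr : 0 < r) : u r ≤ 0 := by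
  by_contra! hpos
  obtain ⟨x, hx, hmax⟩ := exists_isMaxOn_Ioi_of_eventually_le
    (fun y hy => (hu y hy).continuousAt.continuousWithinAt) hr
    (hzero.mono fun y hy => hy.trans hpos.le)
    ((htop.eventually_lt_const hpos).mono fun y hy => hy.le)
  have hux : 0 < u x := hpos.trans_le (hmax hr)
  have hloc : IsLocalMax u x := hmax.isLocalMax (Ioi_mem_nhds hx)
  have hcrit : u' x = 0 := hloc.hasDerivAt_eq_zero (hu x hx)
  have hnonpos : u'' x ≤ 0 :=
    hloc.second_deriv_nonpos (Filter.mem_of_superset (Ioi_mem_nhds hx) hu) (hu' x hx)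
  have hode := hODE x hx
  rw [hcrit, zero_div, add_zero] at hode
  have hexp : Real.exp (-(2 * u x) / 3) < Real.exp (u x / 3) :=
    Real.exp_lt_exp.2 (by linarith)
  linarith


theorem tzitzeica_gaussBonnet
    (N : ℕ) (hN : 0 < N) (u u' u'' : ℝ → ℝ)
    (hder1 : ∀ r ∈ Set.Ioi (0:ℝ), HasDerivAt u (u' r) r)
    (hder2 : ∀ r ∈ Set.Ioi (0:ℝ), HasDerivAt u' (u'' r) r)
    (hcont : ContinuousOn u'' (Set.Ioi (0:ℝ)))
    (hne : ∃ r ∈ Set.Ioi (0:ℝ), u r ≠ 0)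
    (hODE : ∀ r ∈ Set.Ioi (0:ℝ),
      u'' r + u' r / r = Real.exp (u r / 3) - Real.exp (-(2 * u r) / 3))
    (hlim0 : Filter.Tendsto (fun r => r * u' r) (nhdsWithin 0 (Set.Ioi 0))
      (nhds (6 * (N:ℝ) / (2 * (N:ℝ) + 3))))
    (hbot : Filter.Tendsto u (nhdsWithin 0 (Set.Ioi 0)) Filter.atBot)
    (htop : Filter.Tendsto u Filter.atTop (nhds 0))
    (htopder : Filter.Tendsto (fun r => r * u' r) Filter.atTop (nhds 0)) :
    MeasureTheory.IntegrableOn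
      (fun r => (Real.exp (u r / 3) - Real.exp (-(2 * u r) / 3)) * r)
      (Set.Ioi (0:ℝ)) ∧
    ∫ r in Set.Ioi (0:ℝ), (Real.exp (u r / 3) - Real.exp (-(2 * u r) / 3)) * r =
      -(6 * (N:ℝ) / (2 * (N:ℝ) + 3)) := by
  set L : ℝ := 6 * (N : ℝ) / (2 * (N : ℝ) + 3)
  set g : ℝ → ℝ := Function.update (fun r => r * u' r) 0 L
  have hg : ∀ r ∈ Set.Ioi (0 : ℝ), g r = r * u' r := fun r hr =>
    Function.update_of_ne (ne_of_gt hr) _ _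
  have hg_cont : ContinuousWithinAt g (Set.Ici 0) 0 := by
    rw [continuousWithinAt_update_same, Set.Ici_sdiff_left]
    exact hlim0
  have hg_deriv : ∀ r ∈ Set.Ioi (0 : ℝ),
      HasDerivAt g ((Real.exp (u r / 3) - Real.exp (-(2 * u r) / 3)) * r) r := by
    intro r hr
    have hprod := ((hasDerivAt_id r).mul (hder2 r hr)).congr_of_eventuallyEq
      (Filter.mem_of_superset (Ioi_mem_nhds hr) hg)
    have hr0 : r ≠ 0 := ne_of_gt hr
    refine hprod.congr_deriv ?_
    rw [← hODE r hr, id, add_mul, div_mul_cancel₀ _ hr0]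
    ring
  have hg_top : Filter.Tendsto g Filter.atTop (nhds 0) :=
    htopder.congr' ((Filter.eventually_gt_atTop 0).mono fun r hr => (hg r hr).symm)
  have hg_nonpos : ∀ r ∈ Set.Ioi (0 : ℝ),
      (Real.exp (u r / 3) - Real.exp (-(2 * u r) / 3)) * r ≤ 0 := by
    intro r hr
    have hur : u r ≤ 0 :=
      tzitzeica_nonpos_s17 hder1 hder2 hODE (hbot.eventually_le_atBot 0) htop hr
    have hexp : Real.exp (u r / 3) ≤ Real.exp (-(2 * u r) / 3) :=
      Real.exp_le_exp.2 (by linarith)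
    exact mul_nonpos_of_nonpos_of_nonneg (sub_nonpos.2 hexp) (le_of_lt hr)
  refine ⟨MeasureTheory.integrableOn_Ioi_deriv_of_nonpos hg_cont hg_deriv hg_nonpos hg_top, ?_⟩
  rw [MeasureTheory.integral_Ioi_of_hasDerivAt_of_nonpos hg_cont hg_deriv hg_nonpos hg_top]
  simp [g]
end
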